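/- arXiv:2402.16228 — 5 statements merged into one kernel-verified Lean document; each statement's English description precedes it below -/
import Mathlib

section
/- Let H and K be complex Hilbert spaces and A : H → K a bounded linear operator. Then the following five conditions are equivalent: (i) the range of A is closed; (ii) the range of the adjoint A* is closed; (iii) ran A = ran (A ∘ A*); (iv) the range of A ∘ A* is closed; (v) there exists a bounded linear operator X : K → H with A ∘ X ∘ A = A. -/
namespace ContinuousLinearMap

variable {H K : Type*} [NormedAddCommGroup H] [InnerProductSpace ℂ H]
  [NormedAddCommGroup K] [InnerProductSpace ℂ K]

theorem isClosed_range_of_comp_comp_eq_self {A : H →L[ℂ] K} {X : K →L[ℂ] H}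
    (h : A ∘L X ∘L A = A) : IsClosed (Set.range A) := by
  have : Set.range A = {y | A (X y) = y} := by
    ext y
    refine ⟨?_, fun hy ↦ ⟨X y, hy⟩⟩
    rintro ⟨x, rfl⟩
    exact DFunLike.congr_fun h x
  rw [this]
  exact isClosed_eq (by fun_prop) continuous_id

variable [CompleteSpace H]

theorem apply_starProjection_orthogonal_ker (A : H →L[ℂ] K) (x : H) :
    A (A.kerᗮ.starProjection x) = A x := by
  have h : x - A.kerᗮ.starProjection x ∈ A.ker := by
    have := A.kerᗮ.sub_starProjection_mem_orthogonal x
    rwa [Submodule.orthogonal_orthogonal] at this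
  rw [LinearMap.mem_ker, map_sub, sub_eq_zero] at h
  exact h.symm

variable [CompleteSpace K]

theorem exists_comp_comp_eq_self_of_isClosed_range (A : H →L[ℂ] K)
    (hA : IsClosed (Set.range A)) : ∃ X : K →L[ℂ] H, A ∘L X ∘L A = A := by
  let f : A.kerᗮ →L[ℂ] K := A ∘L A.kerᗮ.subtypeL
  have hf_inj : Function.Injective f := by
    refine (injective_iff_map_eq_zero f).2 fun x hx ↦ Subtype.ext ?_
    exact Submodule.disjoint_def.1 A.ker.orthogonal_disjoint x hx x.2
  have hf_range : Set.range f = Set.range A := by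
    refine Set.Subset.antisymm (Set.range_comp_subset_range _ A) ?_
    rintro _ ⟨x, rfl⟩
    exact ⟨⟨_, A.kerᗮ.starProjection_apply_mem x⟩, A.apply_starProjection_orthogonal_ker x⟩
  have hf_closed : IsClosed (Set.range f) := hf_range ▸ hA
  have : CompleteSpace f.range := IsClosed.completeSpace_coe (hs := hf_closed)
  obtain ⟨g, hg⟩ := HasLeftInverse.of_injective_of_isClosed_range_of_closedComplement_range
    hf_inj hf_closed ⟨f.range.orthogonalProjectionOnto, by simp⟩
  refine ⟨A.kerᗮ.subtypeL ∘L g, ContinuousLinearMap.ext fun x ↦ ?_⟩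
  obtain ⟨y, hy⟩ : A x ∈ Set.range f := hf_range ▸ Set.mem_range_self x
  change f (g (A x)) = A x
  rw [← hy, hg y]

theorem isClosed_range_adjoint {A : H →L[ℂ] K} (hA : IsClosed (Set.range A)) :
    IsClosed (Set.range (adjoint A)) := by
  obtain ⟨X, hX⟩ := A.exists_comp_comp_eq_self_of_isClosed_range hA
  refine isClosed_range_of_comp_comp_eq_self (X := adjoint X) ?_
  rw [← comp_assoc, ← adjoint_comp, ← adjoint_comp, hX]

theorem range_adjoint_eq_orthogonal_ker {A : H →L[ℂ] K}
    (hA : IsClosed (Set.range (adjoint A))) : (adjoint A).range = A.kerᗮ := by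
  rw [orthogonal_ker]
  exact (IsClosed.submodule_topologicalClosure_eq hA).symm

theorem range_eq_range_comp_adjoint {A : H →L[ℂ] K}
    (hA : IsClosed (Set.range (adjoint A))) :
    Set.range A = Set.range (A ∘L adjoint A) := by
  refine Set.Subset.antisymm ?_ (Set.range_comp_subset_range _ A)
  rintro _ ⟨x, rfl⟩
  obtain ⟨y, hy⟩ : A.kerᗮ.starProjection x ∈ (adjoint A).range :=
    (range_adjoint_eq_orthogonal_ker hA).ge (A.kerᗮ.starProjection_apply_mem x)
  refine ⟨y, ?_⟩
  rw [← A.apply_starProjection_orthogonal_ker x, ← hy]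
  rfl

theorem isClosed_range_adjoint_of_range_eq {A : H →L[ℂ] K}
    (h : Set.range A = Set.range (A ∘L adjoint A)) : IsClosed (Set.range (adjoint A)) := by
  have hle : (adjoint A).range ≤ A.kerᗮ := by
    rw [orthogonal_ker]
    exact Submodule.le_topologicalClosure _
  have : Set.range (adjoint A) = A.kerᗮ := by
    refine Set.Subset.antisymm hle fun z hz ↦ ?_
    obtain ⟨y, hy⟩ : A z ∈ Set.range (A ∘L adjoint A) := h ▸ Set.mem_range_self z
    refine ⟨y, sub_eq_zero.1 (Submodule.disjoint_def.1 A.ker.orthogonal_disjoint _ ?_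
      (sub_mem (hle ⟨y, rfl⟩) hz))⟩
    rw [LinearMap.mem_ker, map_sub, sub_eq_zero]
    exact hy
  rw [this]
  exact Submodule.isClosed_orthogonal _

theorem range_eq_of_isClosed_range_comp_adjoint {A : H →L[ℂ] K}
    (h : IsClosed (Set.range (A ∘L adjoint A))) :
    Set.range A = Set.range (A ∘L adjoint A) := by
  have hadj : adjoint (A ∘L adjoint A) = A ∘L adjoint A := by
    rw [adjoint_comp, adjoint_adjoint]
  have hker : (A ∘L adjoint A).ker = (adjoint A).ker := by
    simpa using (adjoint A).ker_adjoint_comp_self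
  have hrange := range_adjoint_eq_orthogonal_ker (A := A ∘L adjoint A) (by rwa [hadj])
  rw [hadj, hker, orthogonal_ker, adjoint_adjoint] at hrange
  refine Set.Subset.antisymm ?_ (Set.range_comp_subset_range _ A)
  rintro _ ⟨x, rfl⟩
  have hx : A x ∈ (A ∘L adjoint A).range :=
    hrange ▸ Submodule.le_topologicalClosure _ ⟨x, rfl⟩
  exact hx

end ContinuousLinearMap

/-- Closed range theorem circle of equivalences for a bounded linear operator
between complex Hilbert spaces. -/
theorem stmt_0 {H K : Type*} [NormedAddCommGroup H] [InnerProductSpace ℂ H]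
    [CompleteSpace H] [NormedAddCommGroup K] [InnerProductSpace ℂ K] [CompleteSpace K]
    (A : H →L[ℂ] K) :
    List.TFAE [IsClosed (Set.range A),
      IsClosed (Set.range (ContinuousLinearMap.adjoint A)),
      Set.range A = Set.range (A ∘L ContinuousLinearMap.adjoint A),
      IsClosed (Set.range (A ∘L ContinuousLinearMap.adjoint A)),
      ∃ X : K →L[ℂ] H, A ∘L X ∘L A = A] := by
  have hA_of_adjoint (h : IsClosed (Set.range (ContinuousLinearMap.adjoint A))) :
      IsClosed (Set.range A) := by
    simpa using ContinuousLinearMap.isClosed_range_adjoint h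
  tfae_have 1 → 5 := A.exists_comp_comp_eq_self_of_isClosed_range
  tfae_have 5 → 1 := fun ⟨_, hX⟩ ↦ ContinuousLinearMap.isClosed_range_of_comp_comp_eq_self hX
  tfae_have 1 → 2 := ContinuousLinearMap.isClosed_range_adjoint
  tfae_have 2 → 1 := hA_of_adjoint
  tfae_have 2 → 3 := ContinuousLinearMap.range_eq_range_comp_adjoint
  tfae_have 3 → 2 := ContinuousLinearMap.isClosed_range_adjoint_of_range_eq
  tfae_have 3 → 4 := fun h ↦
    h ▸ hA_of_adjoint (ContinuousLinearMap.isClosed_range_adjoint_of_range_eq h)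
  tfae_have 4 → 3 := ContinuousLinearMap.range_eq_of_isClosed_range_comp_adjoint
  tfae_finish
end

section
/- Let m, n be natural numbers ≥ 1 and let (a_{ij}) be an n×m matrix of real numbers with a_{ij} ≥ 1 for all i, j. Then ∏_{i=1}^n ( ∏_{j=1}^m a_{ij} − ∏_{j=1}^m (a_{ij} − 1) ) ≥ ∏_{j=1}^m ∏_{i=1}^n a_{ij} − ∏_{j=1}^m ( ∏_{i=1}^n a_{ij} − 1 ). Moreover, equality holds if and only if at least one of the following holds: (i) m = 1 or n = 1; (ii) there exists a j such that a_{ij} = 1 for every i; (iii) there exists an i_0 such that a_{ij} = 1 for every i ≠ i_0 and every j. -/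
open Finset

section BooleanExpansion

variable {ι κ : Type*} [Fintype ι] [Fintype κ]

/-- The monomial of `∏ i, ∏ j, (1 + (a i j - 1))` that selects `a i j - 1` where `E i j` holds. -/
def selectionWeight (a : ι → κ → ℝ) (E : ι → κ → Bool) : ℝ :=
  ∏ i, ∏ j, if E i j then a i j - 1 else 1

theorem selectionWeight_nonneg {a : ι → κ → ℝ} (ha : ∀ i j, 1 ≤ a i j) (E : ι → κ → Bool) :
    0 ≤ selectionWeight a E :=
  prod_nonneg fun i _ => prod_nonneg fun j _ => by
    split_ifs
    · exact sub_nonneg.2 (ha i j)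
    · exact zero_le_one

theorem selectionWeight_eq_zero_iff {a : ι → κ → ℝ} {E : ι → κ → Bool} :
    selectionWeight a E = 0 ↔ ∃ i j, E i j = true ∧ a i j = 1 := by
  simp only [selectionWeight, prod_eq_zero_iff, mem_univ, true_and]
  refine exists₂_congr fun i j => ?_
  split_ifs with h <;> simp [h, sub_eq_zero]

variable [DecidableEq ι] [DecidableEq κ]

theorem prod_eq_sum_selection (b : κ → ℝ) :
    ∏ j, b j = ∑ e : κ → Bool, ∏ j, if e j then b j - 1 else 1 := by
  have h := prod_univ_sum (fun _ : κ => (univ : Finset Bool))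
    (fun j (s : Bool) => if s then b j - 1 else (1 : ℝ))
  rw [Fintype.piFinset_univ] at h
  rw [← h]
  exact prod_congr rfl fun j _ => by simp

theorem prod_sub_prod_sub_one_eq_sum (b : κ → ℝ) :
    ∏ j, b j - ∏ j, (b j - 1) =
      ∑ e : κ → Bool with ∃ j, e j = false, ∏ j, if e j then b j - 1 else 1 := by
  have h : (univ.filter fun e : κ → Bool => ∃ j, e j = false) = univ.erase fun _ => true := by
    ext e
    simp [funext_iff]
  rw [h, prod_eq_sum_selection, ← add_sum_erase _ _ (mem_univ fun _ : κ => true)]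
  simp

theorem prod_sub_one_eq_sum (b : κ → ℝ) :
    ∏ j, b j - 1 =
      ∑ e : κ → Bool with ∃ j, e j = true, ∏ j, if e j then b j - 1 else 1 := by
  have h : (univ.filter fun e : κ → Bool => ∃ j, e j = true) = univ.erase fun _ => false := by
    ext e
    simp [funext_iff]
  rw [h, prod_eq_sum_selection, ← add_sum_erase _ _ (mem_univ fun _ : κ => false)]
  simp

theorem prod_sum_filter_eq_sum_selectionWeight (a : ι → κ → ℝ) (p : (κ → Bool) → Prop)
    [DecidablePred p] :
    ∏ i, ∑ e : κ → Bool with p e, ∏ j, (if e j then a i j - 1 else 1) =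
      ∑ E : ι → κ → Bool with ∀ i, p (E i), selectionWeight a E := by
  rw [prod_univ_sum]
  exact sum_congr (by ext E; simp) fun _ _ => rfl

theorem sum_selectionWeight_transpose (a : ι → κ → ℝ) (p : (ι → κ → Bool) → Prop)
    [DecidablePred p] [DecidablePred fun F : κ → ι → Bool => p fun i j => F j i] :
    ∑ F : κ → ι → Bool with p (fun i j => F j i), selectionWeight (fun j i => a i j) F =
      ∑ E : ι → κ → Bool with p E, selectionWeight a E := by
  refine sum_equiv (Equiv.piComm fun _ _ => Bool) (fun F => ?_) fun F _ => ?_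
  · simp only [mem_filter, mem_univ, true_and]
    rfl
  · exact prod_comm

/-- The difference of the two sides counts the selections with no full row and no empty column. -/
theorem prod_rows_sub_prod_columns_eq_sum (a : ι → κ → ℝ) :
    (∏ i, (∏ j, a i j - ∏ j, (a i j - 1))) - (∏ j, ∏ i, a i j - ∏ j, (∏ i, a i j - 1)) =
      ∑ E : ι → κ → Bool with (∀ i, ∃ j, E i j = false) ∧ ∀ j, ∃ i, E i j = true,
        selectionWeight a E := by
  have h_rows : ∏ i, (∏ j, a i j - ∏ j, (a i j - 1)) =
      ∑ E : ι → κ → Bool with ∀ i, ∃ j, E i j = false, selectionWeight a E := by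
    simp_rw [prod_sub_prod_sub_one_eq_sum]
    exact prod_sum_filter_eq_sum_selectionWeight a fun e => ∃ j, e j = false
  have h_columns : ∏ j, (∏ i, a i j - 1) =
      ∑ E : ι → κ → Bool with ∀ j, ∃ i, E i j = true, selectionWeight a E := by
    simp_rw [prod_sub_one_eq_sum]
    rw [prod_sum_filter_eq_sum_selectionWeight (fun j i => a i j) fun e => ∃ i, e i = true]
    exact sum_selectionWeight_transpose a fun E => ∀ j, ∃ i, E i j = true
  have h_total : ∏ j, ∏ i, a i j = ∑ E : ι → κ → Bool, selectionWeight a E := by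
    rw [prod_comm]
    rw [prod_congr rfl fun i _ => prod_eq_sum_selection (a i)]
    simpa using prod_sum_filter_eq_sum_selectionWeight a fun _ => True
  rw [h_rows, h_columns, h_total]
  simp only [sum_filter]
  rw [sub_sub_eq_add_sub, ← sum_add_distrib, ← sum_sub_distrib]
  refine sum_congr rfl fun E _ => ?_
  by_cases hP : ∀ i, ∃ j, E i j = false
  · by_cases hQ : ∀ j, ∃ i, E i j = true <;> simp [hP, hQ]
  · have hQ : ∀ j, ∃ i, E i j = true := by
      push Not at hP
      obtain ⟨i, hi⟩ := hP
      exact fun j => ⟨i, by simpa using hi j⟩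
    simp [hP, hQ]

theorem exists_nonconstant_selector [Nontrivial κ] {r : ι → κ → Prop}
    (h_column : ∀ j, ∃ i, r i j) (h_row : ∀ i₀, ∃ i, i ≠ i₀ ∧ ∃ j, r i j) :
    ∃ c : κ → ι, (∀ j, r (c j) j) ∧ ∀ i, ∃ j, c j ≠ i := by
  choose c hc using h_column
  by_cases h : ∀ i, ∃ j, c j ≠ i
  · exact ⟨c, hc, h⟩
  push Not at h
  obtain ⟨i₀, h_const⟩ := h
  obtain ⟨i, hi, j, hij⟩ := h_row i₀
  refine ⟨Function.update c j i, fun k => ?_, fun k => ?_⟩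
  · rcases eq_or_ne k j with rfl | hk
    · simpa using hij
    · simpa [hk] using hc k
  · rcases eq_or_ne k i with rfl | hk
    · obtain ⟨j', hj'⟩ := exists_ne j
      exact ⟨j', by simpa [hj', h_const] using hi.symm⟩
    · exact ⟨j, by simpa using hk.symm⟩

end BooleanExpansion


/-- Elementary inequality: for reals `a i j ≥ 1` (`n` rows, `m` columns,
`m, n ≥ 1`),
`∏_i (∏_j a i j − ∏_j (a i j − 1)) ≥ ∏_j ∏_i a i j − ∏_j (∏_i a i j − 1)`,
with equality iff (i) `m = 1` or `n = 1`, or (ii) some column is all ones, or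
(iii) some row `i₀` is such that all other rows are all ones. -/
theorem stmt_12 {m n : ℕ} (hm : 1 ≤ m) (hn : 1 ≤ n)
    (a : Fin n → Fin m → ℝ) (ha : ∀ i j, 1 ≤ a i j) :
    ((∏ j, ∏ i, a i j) - ∏ j, ((∏ i, a i j) - 1)
      ≤ ∏ i, ((∏ j, a i j) - ∏ j, (a i j - 1))) ∧
    ((∏ i, ((∏ j, a i j) - ∏ j, (a i j - 1))
        = (∏ j, ∏ i, a i j) - ∏ j, ((∏ i, a i j) - 1))
      ↔ (m = 1 ∨ n = 1) ∨ (∃ j, ∀ i, a i j = 1) ∨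
          (∃ i₀, ∀ i, i ≠ i₀ → ∀ j, a i j = 1)) := by
  have h_diff := prod_rows_sub_prod_columns_eq_sum a
  constructor
  · rw [← sub_nonneg, h_diff]
    exact sum_nonneg fun E _ => selectionWeight_nonneg ha E
  rw [← sub_eq_zero, h_diff, sum_eq_zero_iff_of_nonneg fun E _ => selectionWeight_nonneg ha E]
  simp only [mem_filter, mem_univ, true_and, selectionWeight_eq_zero_iff]
  constructor
  · intro h
    by_contra! h_not
    obtain ⟨⟨h_m, -⟩, h_column, h_row⟩ := h_not
    have : Nontrivial (Fin m) := Fin.nontrivial_iff_two_le.2 (by omega)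
    obtain ⟨c, hc, h_nonconst⟩ :=
      exists_nonconstant_selector (r := fun i j => a i j ≠ 1) h_column h_row
    obtain ⟨i, j, hE, h_one⟩ := h (fun i j => decide (c j = i))
      ⟨fun i => by simpa using h_nonconst i, fun j => ⟨c j, by simp⟩⟩
    obtain rfl : c j = i := by simpa using hE
    exact hc j h_one
  · rintro ((rfl | rfl) | ⟨j, hj⟩ | ⟨i₀, h_row⟩) E ⟨hP, hQ⟩
    · obtain ⟨i, hi⟩ := hQ 0
      obtain ⟨j, hj⟩ := hP i
      simp [Subsingleton.elim j 0, hi] at hj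
    · obtain ⟨j, hj⟩ := hP 0
      obtain ⟨i, hi⟩ := hQ j
      simp [Subsingleton.elim i 0, hj] at hi
    · obtain ⟨i, hi⟩ := hQ j
      exact ⟨i, j, hi, hj i⟩
    · obtain ⟨j, hj⟩ := hP i₀
      obtain ⟨i, hi⟩ := hQ j
      refine ⟨i, j, hi, h_row i ?_ j⟩
      rintro rfl
      simp [hj] at hi
end

section
/- Let m ≥ 1 and for p = 1, …, m let A^p be a positive definite symmetric-partitioned s×s block matrix over ℂ with blocks A^p_{ij} of size n_{ip} × n_{jp}. Set σ_{ip} := ( ∏_{q=1}^m n_{iq} ) / n_{ip} (a positive integer) and let ⊙A := A^1 ∗ ⋯ ∗ A^m be the Khatri–Rao product. Then for each i = 1, …, s: det (⊙A)_i / det (⊙A)_{i−1} ≥ ∏_{p=1}^m det(A^p_{ii})^{σ_{ip}} − ∏_{p=1}^m ( det(A^p_{ii})^{σ_{ip}} − ( det (A^p)_i / det (A^p)_{i−1} )^{σ_{ip}} ). Equality holds if and only if one of the following holds: (a) m = 1 or i = 1; (b) there exists a p such that A^p_{li} = 0 and A^p_{il} = 0 for every l < i; (c) n_{ip} = 1 for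 every p, and there exists i_0 < i such that A^p_{li} = A^p_{l i_0} (A^p_{i_0 i_0})^{−1} A^p_{i_0 i} for every l < i and every p. -/
open scoped ComplexOrder

/-- The `(i, j)` block of a block matrix indexed by a sigma type. -/
def blk {s : ℕ} {α : Fin s → Type*}
    (A : Matrix (Σ i : Fin s, α i) (Σ i : Fin s, α i) ℂ) (i j : Fin s) :
    Matrix (α i) (α j) ℂ :=
  Matrix.of fun x y => A ⟨i, x⟩ ⟨j, y⟩

/-- `blockLeadDet A k` is the determinant of the leading principal block
submatrix of `A` consisting of the first `k` block rows and columns (equal to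
`1` when `k = 0`). -/
noncomputable def blockLeadDet {s : ℕ} {α : Fin s → Type*} [∀ i, Fintype (α i)]
    [∀ i, DecidableEq (α i)]
    (A : Matrix (Σ i : Fin s, α i) (Σ i : Fin s, α i) ℂ) (k : ℕ) : ℂ :=
  (A.submatrix
    (fun x : {y : Σ i : Fin s, α i // (y.1 : ℕ) < k} => x.1)
    (fun x : {y : Σ i : Fin s, α i // (y.1 : ℕ) < k} => x.1)).det

/-- The probability that at least one of a family of independent events of probabilities `w k`,
`k ∈ s`, occurs. -/
def unionProb {κ : Type*} (s : Finset κ) (w : κ → ℝ) : ℝ := 1 - ∏ k ∈ s, (1 - w k)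

section UnionProb

variable {κ : Type*}

theorem unionProb_insert [DecidableEq κ] {s : Finset κ} {a : κ} (ha : a ∉ s) (w : κ → ℝ) :
    unionProb (insert a s) w = w a + (1 - w a) * unionProb s w := by
  simp only [unionProb, Finset.prod_insert ha]
  ring

theorem unionProb_nonneg {s : Finset κ} {w : κ → ℝ} (h0 : ∀ k, 0 ≤ w k) (h1 : ∀ k, w k ≤ 1) :
    0 ≤ unionProb s w :=
  sub_nonneg.2 (Finset.prod_le_one (fun k _ => sub_nonneg.2 (h1 k))
    fun k _ => sub_le_self _ (h0 k))

theorem unionProb_le_one {s : Finset κ} {w : κ → ℝ} (h1 : ∀ k, w k ≤ 1) : unionProb s w ≤ 1 :=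
  sub_le_self _ (Finset.prod_nonneg fun k _ => sub_nonneg.2 (h1 k))

theorem unionProb_lt_one {s : Finset κ} {w : κ → ℝ} (h1 : ∀ k, w k < 1) : unionProb s w < 1 :=
  sub_lt_self _ (Finset.prod_pos fun k _ => sub_pos.2 (h1 k))

theorem unionProb_pos {s : Finset κ} {w : κ → ℝ} (h0 : ∀ k, 0 ≤ w k) (h1 : ∀ k, w k ≤ 1)
    {a : κ} (ha : a ∈ s) (hw : 0 < w a) : 0 < unionProb s w := by
  classical
  have hf := unionProb_nonneg (s := s.erase a) h0 h1
  rw [← Finset.insert_erase ha, unionProb_insert (Finset.notMem_erase a s)]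
  nlinarith [mul_nonneg (sub_nonneg.2 (h1 a)) hf]

theorem unionProb_mul_le (s : Finset κ) {w v : κ → ℝ} (hw0 : ∀ k, 0 ≤ w k) (hw1 : ∀ k, w k ≤ 1)
    (hv0 : ∀ k, 0 ≤ v k) (hv1 : ∀ k, v k ≤ 1) :
    unionProb s (fun k => w k * v k) ≤ unionProb s w * unionProb s v := by
  classical
  induction s using Finset.induction_on with
  | empty => simp [unionProb]
  | insert a s ha ih =>
    rw [unionProb_insert ha, unionProb_insert ha, unionProb_insert ha]
    have hwv : w a * v a ≤ 1 := mul_le_one₀ (hw1 a) (hv0 a) (hv1 a)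
    have h1 := mul_le_mul_of_nonneg_left ih (sub_nonneg.2 hwv)
    have h2 := mul_nonneg (mul_nonneg (hw0 a) (sub_nonneg.2 (hv1 a)))
      (mul_nonneg (unionProb_nonneg (s := s) hv0 hv1)
        (sub_nonneg.2 (unionProb_le_one (s := s) hw1)))
    have h3 := mul_nonneg (mul_nonneg (hv0 a) (sub_nonneg.2 (hw1 a)))
      (mul_nonneg (unionProb_nonneg (s := s) hw0 hw1)
        (sub_nonneg.2 (unionProb_le_one (s := s) hv1)))
    linear_combination h1 + h2 + h3

theorem unionProb_mul_lt {s : Finset κ} {w v : κ → ℝ} (hw0 : ∀ k, 0 ≤ w k) (hw1 : ∀ k, w k < 1)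
    (hv0 : ∀ k, 0 ≤ v k) (hv1 : ∀ k, v k < 1) {a b : κ} (ha : a ∈ s) (hb : b ∈ s) (hab : b ≠ a)
    (hwa : 0 < w a) (hvb : 0 < v b) :
    unionProb s (fun k => w k * v k) < unionProb s w * unionProb s v := by
  classical
  have hins := Finset.insert_erase ha
  have hna := Finset.notMem_erase a s
  have hbt : b ∈ s.erase a := Finset.mem_erase.2 ⟨hab, hb⟩
  generalize s.erase a = t at hins hna hbt
  subst hins
  have hw1' := fun k => (hw1 k).le
  have hv1' := fun k => (hv1 k).le
  rw [unionProb_insert hna, unionProb_insert hna, unionProb_insert hna]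
  have hwv : w a * v a ≤ 1 := mul_le_one₀ (hw1' a) (hv0 a) (hv1' a)
  have h1 := mul_le_mul_of_nonneg_left (unionProb_mul_le t hw0 hw1' hv0 hv1')
    (sub_nonneg.2 hwv)
  have h2 := mul_pos (mul_pos hwa (sub_pos.2 (hv1 a)))
    (mul_pos (unionProb_pos hv0 hv1' hbt hvb) (sub_pos.2 (unionProb_lt_one (s := t) hw1)))
  have h3 := mul_nonneg (mul_nonneg (hv0 a) (sub_nonneg.2 (hw1' a)))
    (mul_nonneg (unionProb_nonneg (s := t) hw0 hw1')
      (sub_nonneg.2 (unionProb_le_one (s := t) hv1')))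
  linear_combination h1 + h2 + h3

theorem unionProb_prod_le {ι : Type*} (t : Finset ι) (s : Finset κ) {u : ι → κ → ℝ}
    (h0 : ∀ p k, 0 ≤ u p k) (h1 : ∀ p k, u p k ≤ 1) :
    unionProb s (fun k => ∏ p ∈ t, u p k) ≤ ∏ p ∈ t, unionProb s (u p) := by
  classical
  induction t using Finset.induction_on with
  | empty => simpa using unionProb_le_one (s := s) (w := fun _ => 1) fun _ => le_rfl
  | insert q t hq ih =>
    simp only [Finset.prod_insert hq]
    exact (unionProb_mul_le s (h0 q) (h1 q) (fun k => Finset.prod_nonneg fun p _ => h0 p k)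
      fun k => Finset.prod_le_one (fun p _ => h0 p k) fun p _ => h1 p k).trans
        (mul_le_mul_of_nonneg_left ih (unionProb_nonneg (h0 q) (h1 q)))

theorem unionProb_prod_eq_iff {ι : Type*} [Fintype ι] [DecidableEq ι] {α : ι → Type*}
    [∀ p, Fintype (α p)] [∀ p, DecidableEq (α p)] {x : ∀ p, α p → ℝ}
    (h0 : ∀ p k, 0 ≤ x p k) (h1 : ∀ p k, x p k < 1) :
    unionProb Finset.univ (fun k : ∀ p, α p => ∏ p, x p (k p)) =
        ∏ p, unionProb Finset.univ (fun k : ∀ p, α p => x p (k p)) ↔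
      (∃ p, x p = 0) ∨ (Nonempty ι ∧ Subsingleton ι) ∨ ∀ p, Fintype.card (α p) = 1 := by
  constructor
  · intro h
    by_contra! hne
    obtain ⟨hx, hι, q, hq⟩ := hne
    have hpos : ∀ p, ∃ j, 0 < x p j := fun p => by
      by_contra! hp
      exact hx p (funext fun j => le_antisymm (hp j) (h0 p j))
    choose j hj using hpos
    have : Nonempty ι := ⟨q⟩
    obtain ⟨q', hq'⟩ : ∃ q', q' ≠ q := by
      have := hι this
      exact exists_ne q
    obtain ⟨j', hj'⟩ : ∃ j', j' ≠ j q := by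
      have : 1 < Fintype.card (α q) :=
        lt_of_le_of_ne (Fintype.card_pos_iff.2 ⟨j q⟩) (Ne.symm hq)
      exact Fintype.exists_ne_of_one_lt_card this _
    have h1' := fun p k => (h1 p k).le
    have hlt := unionProb_mul_lt (s := Finset.univ)
      (w := fun k : ∀ p, α p => ∏ p ∈ Finset.univ.erase q, x p (k p))
      (v := fun k : ∀ p, α p => x q (k q)) (a := Function.update j q j') (b := j)
      (fun k => Finset.prod_nonneg fun p _ => h0 p _)
      (fun k => by
        rw [← Finset.mul_prod_erase _ _ (Finset.mem_erase.2 ⟨hq', Finset.mem_univ q'⟩)]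
        exact mul_lt_one_of_nonneg_of_lt_one_left (h0 _ _) (h1 _ _)
          (Finset.prod_le_one (fun p _ => h0 p _) fun p _ => h1' p _))
      (fun k => h0 q _) (fun k => h1 q _) (Finset.mem_univ _) (Finset.mem_univ _)
      (fun hjj => hj' (by rw [hjj]; simp))
      (Finset.prod_pos fun p hp => by
        rw [Function.update_of_ne (Finset.ne_of_mem_erase hp)]
        exact hj p)
      (hj q)
    have hle := unionProb_prod_le (Finset.univ.erase q) Finset.univ
      (u := fun p (k : ∀ p, α p) => x p (k p)) (fun p k => h0 p _) (fun p k => h1' p _)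
    have hle' := mul_le_mul_of_nonneg_right hle
      (unionProb_nonneg (s := Finset.univ) (w := fun k : ∀ p, α p => x q (k q))
        (fun k => h0 q _) fun k => h1' q _)
    simp only [Finset.prod_erase_mul _ _ (Finset.mem_univ q)] at hlt hle'
    exact absurd h (hlt.trans_le hle').ne
  · rintro (⟨p, hp⟩ | ⟨⟨p⟩, hι⟩ | hα)
    · rw [Finset.prod_eq_zero (Finset.mem_univ p) (by simp [unionProb, hp])]
      have : ∀ k : ∀ p, α p, ∏ p, x p (k p) = 0 := fun k =>
        Finset.prod_eq_zero (Finset.mem_univ p) (by simp [hp])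
      simp [unionProb, this]
    · simp only [Fintype.prod_subsingleton _ p]
    · have : ∀ p, Subsingleton (α p) := fun p =>
        Fintype.card_le_one_iff_subsingleton.1 (hα p).le
      have : ∀ p, Nonempty (α p) := fun p => Fintype.card_pos_iff.1 (by simp [hα p])
      have k : ∀ p, α p := fun p => Classical.choice (this p)
      simp only [unionProb, Fintype.prod_subsingleton _ k, sub_sub_cancel]

end UnionProb

open Matrix

/-- The entrywise product of a family of matrices, i.e. their Kronecker product with rows and
columns indexed by dependent functions. -/
def piKron {ι : Type*} [Fintype ι] {α β : ι → Type*} (P : ∀ p, Matrix (α p) (β p) ℂ) :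
    Matrix (∀ p, α p) (∀ p, β p) ℂ :=
  of fun x y => ∏ p, P p (x p) (y p)

section PiKron

variable {ι : Type*} [Fintype ι] {α β γ : ι → Type*}

theorem piKron_apply (P : ∀ p, Matrix (α p) (β p) ℂ) (x : ∀ p, α p) (y : ∀ p, β p) :
    piKron P x y = ∏ p, P p (x p) (y p) := rfl

theorem piKron_mul [DecidableEq ι] [∀ p, Fintype (β p)] (P : ∀ p, Matrix (α p) (β p) ℂ)
    (Q : ∀ p, Matrix (β p) (γ p) ℂ) :
    piKron P * piKron Q = piKron fun p => P p * Q p := by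
  ext x y
  simp only [mul_apply, piKron_apply, ← Finset.prod_mul_distrib]
  rw [Finset.prod_univ_sum, Fintype.piFinset_univ]

theorem conjTranspose_piKron (P : ∀ p, Matrix (α p) (β p) ℂ) :
    (piKron P)ᴴ = piKron fun p => (P p)ᴴ := by
  ext x y
  simp [piKron_apply]

theorem piKron_diagonal [∀ p, DecidableEq (α p)] (d : ∀ p, α p → ℂ) :
    piKron (fun p => diagonal (d p)) = diagonal fun k : ∀ p, α p => ∏ p, d p (k p) := by
  ext x y
  rw [piKron_apply]
  by_cases h : x = y
  · subst h
    simp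
  · obtain ⟨p, hp⟩ := Function.ne_iff.1 h
    rw [diagonal_apply_ne _ h, Finset.prod_eq_zero (Finset.mem_univ p)]
    exact diagonal_apply_ne _ hp

theorem piKron_one [∀ p, DecidableEq (α p)] :
    piKron (fun p => (1 : Matrix (α p) (α p) ℂ)) = 1 := by
  simp only [← diagonal_one, piKron_diagonal, Finset.prod_const_one]

theorem inv_piKron [DecidableEq ι] [∀ p, Fintype (α p)] [∀ p, DecidableEq (α p)]
    {P : ∀ p, Matrix (α p) (α p) ℂ} (hP : ∀ p, IsUnit (P p)) :
    (piKron P)⁻¹ = piKron fun p => (P p)⁻¹ := by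
  refine inv_eq_right_inv ?_
  simp only [piKron_mul, fun p => mul_nonsing_inv (P p) ((isUnit_iff_isUnit_det _).1 (hP p)),
    piKron_one]

theorem isUnit_piKron [DecidableEq ι] [∀ p, Fintype (α p)] [∀ p, DecidableEq (α p)]
    {P : ∀ p, Matrix (α p) (α p) ℂ} (hP : ∀ p, IsUnit (P p)) : IsUnit (piKron P) := by
  refine IsUnit.of_mul_eq_one (piKron fun p => (P p)⁻¹) ?_
  simp only [piKron_mul, fun p => mul_nonsing_inv (P p) ((isUnit_iff_isUnit_det _).1 (hP p)),
    piKron_one]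

theorem prod_pi_apply [DecidableEq ι] {R : Type*} [CommMonoid R] [∀ p, Fintype (α p)] (p : ι) (g : α p → R) :
    ∏ k : ∀ p, α p, g (k p) =
      (∏ j, g j) ^ ∏ q ∈ Finset.univ.erase p, Fintype.card (α q) := by
  have h : ∏ k : ∀ p, α p, g (k p) = ∏ z : α p × ∀ q : {q // q ≠ p}, α q, g z.1 :=
    Fintype.prod_equiv (Equiv.piSplitAt p α) _ _ fun _ => rfl
  rw [h, Fintype.prod_prod_type]
  simp only [Finset.prod_const, Finset.prod_pow, Finset.card_univ, Fintype.card_pi]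
  congr 1
  exact (Finset.prod_subtype (Finset.univ.erase p) (by simp) fun q => Fintype.card (α q)).symm

end PiKron

section Definite

variable {n : Type*} [Fintype n] [DecidableEq n]

open scoped MatrixOrder in
theorem Matrix.PosDef.exists_isUnit_eq_conjTranspose_mul_self {D : Matrix n n ℂ}
    (hD : D.PosDef) : ∃ Q : Matrix n n ℂ, IsUnit Q ∧ D = Qᴴ * Q :=
  CStarAlgebra.isStrictlyPositive_iff_eq_star_mul_self.1 (isStrictlyPositive_iff_posDef.2 hD)

/-- Simultaneous diagonalization by congruence of a positive definite and a positive semidefinite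
matrix. -/
theorem Matrix.PosDef.exists_simultaneous_diagonal {D X : Matrix n n ℂ} (hD : D.PosDef)
    (hX : X.PosSemidef) : ∃ (Q : Matrix n n ℂ) (x : n → ℝ), IsUnit Q ∧ D = Qᴴ * Q ∧
      X = Qᴴ * diagonal (fun k => (x k : ℂ)) * Q ∧ ∀ k, 0 ≤ x k := by
  obtain ⟨R, hR, rfl⟩ := hD.exists_isUnit_eq_conjTranspose_mul_self
  have hRdet := (isUnit_iff_isUnit_det _).1 hR
  have hY : ((R⁻¹)ᴴ * X * R⁻¹).PosSemidef := hX.conjTranspose_mul_mul_same R⁻¹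
  have hspec := hY.1.spectral_theorem
  rw [Unitary.conjStarAlgAut_apply] at hspec
  have hx := hY.eigenvalues_nonneg
  generalize hY.1.eigenvectorUnitary = U at hspec
  generalize hY.1.eigenvalues = x at hspec hx
  have hUU : (U : Matrix n n ℂ) * (U : Matrix n n ℂ)ᴴ = 1 := Unitary.coe_mul_star_self U
  have hUU' : (U : Matrix n n ℂ)ᴴ * (U : Matrix n n ℂ) = 1 := Unitary.coe_star_mul_self U
  refine ⟨(U : Matrix n n ℂ)ᴴ * R, x, ?_, ?_, ?_, hx⟩
  · exact (IsUnit.of_mul_eq_one _ hUU').mul hR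
  · rw [conjTranspose_mul, conjTranspose_conjTranspose, Matrix.mul_assoc,
      ← Matrix.mul_assoc (U : Matrix n n ℂ), hUU, Matrix.one_mul]
  · have hRR : Rᴴ * (R⁻¹)ᴴ = 1 := by
      rw [← conjTranspose_mul, nonsing_inv_mul _ hRdet, conjTranspose_one]
    calc X = (Rᴴ * (R⁻¹)ᴴ) * X * (R⁻¹ * R) := by
          rw [hRR, nonsing_inv_mul _ hRdet, Matrix.one_mul, Matrix.mul_one]
      _ = Rᴴ * ((R⁻¹)ᴴ * X * R⁻¹) * R := by simp only [Matrix.mul_assoc]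
      _ = _ := by
        rw [hspec, conjTranspose_mul, conjTranspose_conjTranspose]
        simp only [Matrix.mul_assoc]
        rfl

theorem Matrix.PosDef.conjTranspose_mul_mul_eq_zero_iff {N : Type*} [Fintype N]
    {K : Matrix n n ℂ} (hK : K.PosDef) {c : Matrix n N ℂ} : cᴴ * K * c = 0 ↔ c = 0 := by
  obtain ⟨R, hR, rfl⟩ := hK.exists_isUnit_eq_conjTranspose_mul_self
  rw [← Matrix.mul_assoc, ← conjTranspose_mul, Matrix.mul_assoc, conjTranspose_mul_self_eq_zero]
  constructor
  · intro h
    rw [← Matrix.one_mul c, ← nonsing_inv_mul R ((isUnit_iff_isUnit_det _).1 hR),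
      Matrix.mul_assoc, h, Matrix.mul_zero]
  · rintro rfl
    exact Matrix.mul_zero _

theorem conjTranspose_mul_diagonal_mul_eq_zero_iff {Q : Matrix n n ℂ} (hQ : IsUnit Q)
    {x : n → ℝ} : Qᴴ * diagonal (fun k => (x k : ℂ)) * Q = 0 ↔ x = 0 := by
  rw [hQ.mul_left_eq_zero, ← star_eq_conjTranspose, hQ.star.mul_right_eq_zero,
    diagonal_eq_zero, funext_iff, funext_iff]
  simp

theorem det_conjTranspose_mul_diagonal_mul (Q : Matrix n n ℂ) (x : n → ℝ) :
    (Qᴴ * diagonal (fun k => (x k : ℂ)) * Q).det = (Qᴴ * Q).det * ((∏ k, x k : ℝ) : ℂ) := by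
  rw [det_mul, det_mul, det_mul, det_diagonal]
  push_cast
  ring

theorem conjTranspose_mul_self_add_diagonal (Q : Matrix n n ℂ) (x : n → ℝ) :
    Qᴴ * Q + Qᴴ * diagonal (fun k => (x k : ℂ)) * Q =
      Qᴴ * diagonal (fun k => ((1 + x k : ℝ) : ℂ)) * Q := by
  have : diagonal (fun k => ((1 + x k : ℝ) : ℂ)) =
      (1 : Matrix n n ℂ) + diagonal fun k => (x k : ℂ) := by
    rw [← diagonal_one, diagonal_add]
    simp
  rw [this, Matrix.mul_add, Matrix.add_mul, Matrix.mul_one]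

theorem conjTranspose_mul_self_sub_diagonal (Q : Matrix n n ℂ) (x : n → ℝ) :
    Qᴴ * Q - Qᴴ * diagonal (fun k => (x k : ℂ)) * Q =
      Qᴴ * diagonal (fun k => ((1 - x k : ℝ) : ℂ)) * Q := by
  have h := conjTranspose_mul_self_add_diagonal Q fun k => 1 - x k - 1
  have h' : diagonal (fun k => ((1 - x k - 1 : ℝ) : ℂ)) = -diagonal fun k => (x k : ℂ) := by
    rw [diagonal_neg]
    simp
  simpa only [h', Matrix.mul_neg, Matrix.neg_mul, add_sub_cancel, ← sub_eq_add_neg] using h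

theorem Matrix.PosDef.det_eq_re {T : Matrix n n ℂ} (hT : T.PosDef) : T.det = (T.det.re : ℂ) :=
  Complex.ext (by simp) (by simpa using (Complex.pos_iff.1 hT.det_pos).2.symm)

theorem Matrix.PosDef.det_re_pos {T : Matrix n n ℂ} (hT : T.PosDef) : 0 < T.det.re :=
  (Complex.pos_iff.1 hT.det_pos).1

theorem one_add_sum_le_prod_one_add {κ : Type*} (s : Finset κ) {x : κ → ℝ} (hx : ∀ k, 0 ≤ x k) :
    1 + ∑ k ∈ s, x k ≤ ∏ k ∈ s, (1 + x k) := by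
  classical
  induction s using Finset.induction_on with
  | empty => simp
  | insert a s ha ih =>
    rw [Finset.sum_insert ha, Finset.prod_insert ha]
    nlinarith [hx a, mul_nonneg (hx a) (Finset.sum_nonneg fun k (_ : k ∈ s) => hx k),
      mul_le_mul_of_nonneg_left ih (add_nonneg zero_le_one (hx a))]

theorem Matrix.PosDef.det_re_le_det_add_re {T P : Matrix n n ℂ} (hT : T.PosDef)
    (hP : P.PosSemidef) :
    T.det.re ≤ (T + P).det.re ∧ ((T + P).det.re = T.det.re ↔ P = 0) := by
  obtain ⟨Q, x, hQ, rfl, rfl, hx⟩ := hT.exists_simultaneous_diagonal hP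
  have hsum := one_add_sum_le_prod_one_add Finset.univ hx
  have hsum0 : 0 ≤ ∑ k, x k := Finset.sum_nonneg fun k _ => hx k
  rw [conjTranspose_mul_self_add_diagonal, det_conjTranspose_mul_diagonal_mul,
    Complex.re_mul_ofReal, conjTranspose_mul_diagonal_mul_eq_zero_iff hQ]
  refine ⟨le_mul_of_one_le_right hT.det_re_pos.le (by linarith), fun h => ?_, fun h => ?_⟩
  · rw [mul_eq_left₀ hT.det_re_pos.ne'] at h
    exact funext fun k => (Finset.sum_eq_zero_iff_of_nonneg fun k _ => hx k).1
      (le_antisymm (by linarith) hsum0) k (Finset.mem_univ k)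
  · simp [h]

theorem piKron_posDef {ι : Type*} [Fintype ι] [DecidableEq ι] {α : ι → Type*}
    [∀ p, Fintype (α p)] [∀ p, DecidableEq (α p)] {P : ∀ p, Matrix (α p) (α p) ℂ}
    (hP : ∀ p, (P p).PosDef) : (piKron P).PosDef := by
  choose Q hQ hPQ using fun p => (hP p).exists_isUnit_eq_conjTranspose_mul_self
  have : piKron P = (piKron Q)ᴴ * piKron Q := by
    rw [conjTranspose_piKron, piKron_mul]
    simp only [← hPQ]
  rw [this]
  exact PosDef.conjTranspose_mul_self _ (mulVec_injective_of_isUnit (isUnit_piKron hQ))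

theorem det_piKron_of_posDef {ι : Type*} [Fintype ι] [DecidableEq ι] {α : ι → Type*}
    [∀ p, Fintype (α p)] [∀ p, DecidableEq (α p)] {P : ∀ p, Matrix (α p) (α p) ℂ}
    (hP : ∀ p, (P p).PosDef) :
    (piKron P).det = ∏ p, (P p).det ^ ∏ q ∈ Finset.univ.erase p, Fintype.card (α q) := by
  choose Q x hQ h1 hPQ hx using fun p =>
    PosDef.one.exists_simultaneous_diagonal (hP p).posSemidef
  have h1' : (1 : Matrix (∀ p, α p) (∀ p, α p) ℂ) = (piKron Q)ᴴ * piKron Q := by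
    rw [conjTranspose_piKron, piKron_mul, ← piKron_one]
    simp only [← h1]
  have hPQ' : piKron P = (piKron Q)ᴴ * piKron (fun p => diagonal fun k => (x p k : ℂ)) *
      piKron Q := by
    rw [conjTranspose_piKron, piKron_mul, piKron_mul]
    simp only [← hPQ]
  have hdet := fun p => congrArg det (h1 p)
  have hdet' := congrArg det h1'
  simp only [det_mul, det_one] at hdet hdet'
  rw [hPQ', piKron_diagonal, det_mul, det_mul, mul_right_comm, ← hdet', one_mul, det_diagonal,
    Finset.prod_comm]
  refine Finset.prod_congr rfl fun p _ => ?_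
  rw [prod_pi_apply p fun k => (x p k : ℂ), hPQ p, det_mul, det_mul, mul_right_comm, ← hdet,
    one_mul, det_diagonal]

end Definite

section Compression

variable {I J N : Type*} [Fintype I] [DecidableEq I] [Fintype J] [DecidableEq J] [Fintype N]

omit [Fintype I] [DecidableEq J] [Fintype N] in
theorem one_submatrix_mul_apply_of_notMem_range {e : J → I} (v : Matrix J N ℂ) {z : I}
    (hz : z ∉ Set.range e) (k : N) : ((1 : Matrix I I ℂ).submatrix id e * v) z k = 0 := by
  rw [mul_apply]
  refine Finset.sum_eq_zero fun a _ => ?_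
  rw [submatrix_apply, id, one_apply_ne, zero_mul]
  rintro rfl
  exact hz ⟨a, rfl⟩

omit [DecidableEq I] [DecidableEq J] [Fintype N] in
theorem mul_eq_submatrix_mul_submatrix {L : Type*} {e : J → I} (he : Function.Injective e)
    {y : Matrix I N ℂ} (hy : ∀ z ∉ Set.range e, ∀ k, y z k = 0) (K : Matrix L I ℂ) :
    K * y = K.submatrix id e * y.submatrix e id := by
  ext l k
  rw [mul_apply, mul_apply]
  refine (Fintype.sum_of_injective e he _ _ (fun z hz => ?_) fun a => rfl).symm
  rw [hy z hz, mul_zero]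

/-- Restricting a positive definite `K` and a right factor `c` to a subset of the indices decreases
`cᴴ K⁻¹ c`; nothing is lost iff `K⁻¹ c` is supported on this subset. -/
theorem Matrix.PosDef.compression {K : Matrix I I ℂ} (hK : K.PosDef) (c : Matrix I N ℂ)
    {e : J → I} (he : Function.Injective e) :
    (cᴴ * K⁻¹ * c -
      (c.submatrix e id)ᴴ * (K.submatrix e e)⁻¹ * c.submatrix e id).PosSemidef ∧
    (cᴴ * K⁻¹ * c -
      (c.submatrix e id)ᴴ * (K.submatrix e e)⁻¹ * c.submatrix e id = 0 ↔
        ∀ z ∉ Set.range e, ∀ k, (K⁻¹ * c) z k = 0) := by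
  have hK0 : (K.submatrix e e).PosDef := hK.submatrix he
  set E : Matrix I J ℂ := (1 : Matrix I I ℂ).submatrix id e with hE
  have hEc : c.submatrix e id = Eᴴ * c := by
    ext a k
    simp [hE, mul_apply, one_apply]
  have hEK : K.submatrix e e = Eᴴ * K * E := by
    ext a b
    simp [hE, mul_apply, one_apply]
  rw [hEc, hEK]
  rw [hEK] at hK0
  set L := Eᴴ * K * E with hL
  have hKu := (isUnit_iff_isUnit_det _).1 hK.isUnit
  have hLu := (isUnit_iff_isUnit_det _).1 hK0.isUnit
  set w := L⁻¹ * (Eᴴ * c) with hw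
  have hKi : (K⁻¹)ᴴ = K⁻¹ := hK.inv.1
  have hLi : (L⁻¹)ᴴ = L⁻¹ := hK0.inv.1
  have key : cᴴ * K⁻¹ * c - (Eᴴ * c)ᴴ * L⁻¹ * (Eᴴ * c) =
      (K⁻¹ * c - E * w)ᴴ * K * (K⁻¹ * c - E * w) := by
    have h1 : Eᴴ * K * (E * w) = Eᴴ * c := by
      rw [← Matrix.mul_assoc, ← hL, hw, ← Matrix.mul_assoc, mul_nonsing_inv _ hLu, Matrix.one_mul]
    have h2 : K * (K⁻¹ * c - E * w) = c - K * (E * w) := by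
      rw [Matrix.mul_sub, ← Matrix.mul_assoc K, mul_nonsing_inv _ hKu, Matrix.one_mul]
    have h3 : Eᴴ * (c - K * (E * w)) = 0 := by
      rw [Matrix.mul_sub, ← Matrix.mul_assoc Eᴴ K, h1, sub_self]
    rw [Matrix.mul_assoc _ K, h2, conjTranspose_sub, Matrix.sub_mul, conjTranspose_mul E,
      Matrix.mul_assoc wᴴ, h3, Matrix.mul_zero, sub_zero, conjTranspose_mul, conjTranspose_mul, hKi,
      conjTranspose_conjTranspose, Matrix.mul_sub,
      Matrix.mul_assoc cᴴ K⁻¹ (K * _), ← Matrix.mul_assoc K⁻¹ K, nonsing_inv_mul _ hKu,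
      Matrix.one_mul, hw]
    simp only [Matrix.mul_assoc]
  refine ⟨key ▸ hK.posSemidef.conjTranspose_mul_mul_same _, ?_⟩
  rw [key, hK.conjTranspose_mul_mul_eq_zero_iff, sub_eq_zero]
  constructor
  · intro h
    rw [h]
    exact fun z hz k => one_submatrix_mul_apply_of_notMem_range w hz k
  · intro h
    have hsupp := mul_eq_submatrix_mul_submatrix he h (1 : Matrix I I ℂ)
    rw [Matrix.one_mul, ← hE] at hsupp
    have hLw : L * (K⁻¹ * c).submatrix e id = Eᴴ * c := by
      rw [hL, Matrix.mul_assoc, ← hsupp, Matrix.mul_assoc, ← Matrix.mul_assoc K,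
        mul_nonsing_inv _ hKu, Matrix.one_mul]
    rw [hw, ← hLw, ← Matrix.mul_assoc L⁻¹, nonsing_inv_mul _ hLu, Matrix.one_mul, ← hsupp]

end Compression

section Core

variable {ι : Type*} [Fintype ι] [DecidableEq ι] [Nonempty ι] {I N : ι → Type*}
  [∀ p, Fintype (I p)] [∀ p, DecidableEq (I p)] [∀ p, Fintype (N p)] [∀ p, DecidableEq (N p)]
  {J : Type*} [Fintype J] [DecidableEq J]

/-- Oppenheim–Schur inequality for the Schur complement of a block matrix of Kronecker products
whose first block row and column are restricted along `e`. -/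
theorem det_schurComplement_piKron {e : J → ∀ p, I p} (he : Function.Injective e)
    {B : ∀ p, Matrix (I p) (I p) ℂ} {C : ∀ p, Matrix (I p) (N p) ℂ}
    {D : ∀ p, Matrix (N p) (N p) ℂ} (hB : ∀ p, (B p).PosDef) (hD : ∀ p, (D p).PosDef)
    (hS : ∀ p, (D p - (C p)ᴴ * (B p)⁻¹ * C p).PosDef) :
    let σ : ι → ℕ := fun p => ∏ q ∈ Finset.univ.erase p, Fintype.card (N q)
    let lhs := (piKron D - ((piKron C).submatrix e id)ᴴ * ((piKron B).submatrix e e)⁻¹ *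
      (piKron C).submatrix e id).det.re
    let rhs := ∏ p, (D p).det.re ^ σ p - ∏ p, ((D p).det.re ^ σ p -
      (D p - (C p)ᴴ * (B p)⁻¹ * C p).det.re ^ σ p)
    rhs ≤ lhs ∧ (lhs = rhs ↔ (∃ p, C p = 0) ∨
      ((Subsingleton ι ∨ ∀ p, Fintype.card (N p) = 1) ∧
        ∀ z ∉ Set.range e, ∀ k : ∀ p, N p, ∏ p, ((B p)⁻¹ * C p) (z p) (k p) = 0)) := by
  intro σ lhs rhs
  have hX : ∀ p, ((C p)ᴴ * (B p)⁻¹ * C p).PosSemidef := fun p =>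
    (hB p).inv.posSemidef.conjTranspose_mul_mul_same _
  choose Q x hQ hDQ hXQ hx0 using fun p => (hD p).exists_simultaneous_diagonal (hX p)
  have hSQ : ∀ p, D p - (C p)ᴴ * (B p)⁻¹ * C p =
      (Q p)ᴴ * diagonal (fun k => ((1 - x p k : ℝ) : ℂ)) * Q p := fun p => by
    rw [hXQ p, hDQ p, conjTranspose_mul_self_sub_diagonal]
  have hx1 : ∀ p k, x p k < 1 := fun p k => by
    have h := hS p
    rw [hSQ p] at h
    have h' := posDef_diagonal_iff.1 ((hQ p).posDef_star_left_conjugate_iff.1 h) k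
    exact sub_pos.1 (Complex.zero_lt_real.1 h')
  have hxC : ∀ p, x p = 0 ↔ C p = 0 := fun p => by
    rw [← conjTranspose_mul_diagonal_mul_eq_zero_iff (hQ p), ← hXQ p,
      (hB p).inv.conjTranspose_mul_mul_eq_zero_iff]
  have hinv := inv_piKron fun p => (hB p).isUnit
  have hDk : piKron D = (piKron Q)ᴴ * piKron Q := by
    rw [conjTranspose_piKron, piKron_mul]
    simp only [← hDQ]
  have hXk : (piKron C)ᴴ * (piKron B)⁻¹ * piKron C = (piKron Q)ᴴ *
      diagonal (fun k : ∀ p, N p => ((∏ p, x p (k p) : ℝ) : ℂ)) * piKron Q := by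
    have : diagonal (fun k : ∀ p, N p => ((∏ p, x p (k p) : ℝ) : ℂ)) =
        piKron fun p => diagonal fun k => (x p k : ℂ) := by
      rw [piKron_diagonal]
      push_cast
      rfl
    rw [this, hinv, conjTranspose_piKron, conjTranspose_piKron, piKron_mul, piKron_mul,
      piKron_mul, piKron_mul]
    simp only [← hXQ]
  have hlt : ∀ k : ∀ p, N p, ∏ p, x p (k p) < 1 := fun k => by
    obtain ⟨q⟩ := ‹Nonempty ι›
    rw [← Finset.mul_prod_erase _ _ (Finset.mem_univ q)]
    exact mul_lt_one_of_nonneg_of_lt_one_left (hx0 _ _) (hx1 _ _)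
      (Finset.prod_le_one (fun p _ => hx0 p _) fun p _ => (hx1 p _).le)
  have hT : piKron D - (piKron C)ᴴ * (piKron B)⁻¹ * piKron C = (piKron Q)ᴴ *
      diagonal (fun k : ∀ p, N p => ((1 - ∏ p, x p (k p) : ℝ) : ℂ)) * piKron Q := by
    rw [hXk, hDk, conjTranspose_mul_self_sub_diagonal]
  have hTpos : (piKron D - (piKron C)ᴴ * (piKron B)⁻¹ * piKron C).PosDef := by
    rw [hT]
    refine (isUnit_piKron hQ).posDef_star_left_conjugate_iff.2 (posDef_diagonal_iff.2 fun k => ?_)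
    exact Complex.zero_lt_real.2 (sub_pos.2 (hlt k))
  have hdet : (piKron D).det = ((∏ p, (D p).det.re ^ σ p : ℝ) : ℂ) := by
    rw [det_piKron_of_posDef hD]
    push_cast
    exact Finset.prod_congr rfl fun p _ => by rw [← (hD p).det_eq_re]
  have hG : 0 < ∏ p, (D p).det.re ^ σ p :=
    Finset.prod_pos fun p _ => pow_pos (hD p).det_re_pos _
  have hTdet : (piKron D - (piKron C)ᴴ * (piKron B)⁻¹ * piKron C).det.re =
      (∏ p, (D p).det.re ^ σ p) *
        (1 - unionProb Finset.univ fun k : ∀ p, N p => ∏ p, x p (k p)) := by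
    rw [hT, det_conjTranspose_mul_diagonal_mul, ← hDk, hdet, ← Complex.ofReal_mul,
      Complex.ofReal_re, unionProb, sub_sub_cancel]
  have hrhs : rhs = (∏ p, (D p).det.re ^ σ p) *
      (1 - ∏ p, unionProb Finset.univ fun k : ∀ p, N p => x p (k p)) := by
    rw [mul_sub, mul_one, ← Finset.prod_mul_distrib]
    refine congrArg (_ - ·) (Finset.prod_congr rfl fun p _ => ?_)
    rw [hSQ p, det_conjTranspose_mul_diagonal_mul, ← hDQ, Complex.re_mul_ofReal, mul_pow,
      unionProb, prod_pi_apply p fun j => 1 - x p j, mul_sub, mul_one]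
  have hunion := unionProb_prod_le Finset.univ Finset.univ
    (u := fun p (k : ∀ p, N p) => x p (k p)) (fun p k => hx0 p _) fun p k => (hx1 p _).le
  obtain ⟨hcomp, hcomp0⟩ := (piKron_posDef hB).compression (piKron C) he
  obtain ⟨hle, heq⟩ := hTpos.det_re_le_det_add_re hcomp
  rw [sub_add_sub_cancel] at hle heq
  rw [hcomp0] at heq
  rw [hTdet] at hle heq
  have hle' : rhs ≤ (∏ p, (D p).det.re ^ σ p) *
      (1 - unionProb Finset.univ fun k : ∀ p, N p => ∏ p, x p (k p)) := by
    rw [hrhs]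
    exact mul_le_mul_of_nonneg_left (sub_le_sub_left hunion 1) hG.le
  have hsupp : ∀ z (k : ∀ p, N p), ((piKron B)⁻¹ * piKron C) z k =
      ∏ p, ((B p)⁻¹ * C p) (z p) (k p) := fun z k => by
    rw [hinv, piKron_mul, piKron_apply]
  simp only [hsupp] at heq
  refine ⟨hle'.trans hle, ?_⟩
  have hsplit : lhs = rhs ↔ (∀ z ∉ Set.range e, ∀ k : ∀ p, N p,
      ∏ p, ((B p)⁻¹ * C p) (z p) (k p) = 0) ∧ ((∃ p, x p = 0) ∨
        (Nonempty ι ∧ Subsingleton ι) ∨ ∀ p, Fintype.card (N p) = 1) := by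
    rw [← heq, ← unionProb_prod_eq_iff hx0 hx1]
    constructor
    · intro h
      have h1 := le_antisymm (h.le.trans hle') hle
      refine ⟨h1, ?_⟩
      have h2 := h1.symm.trans (h.trans hrhs)
      linarith [mul_left_cancel₀ hG.ne' h2]
    · rintro ⟨h1, h2⟩
      rw [hrhs, ← h2]
      exact h1
  rw [hsplit]
  simp only [hxC]
  have hzero : (∃ p, C p = 0) → ∀ z ∉ Set.range e, ∀ k : ∀ p, N p,
      ∏ p, ((B p)⁻¹ * C p) (z p) (k p) = 0 := by
    rintro ⟨p, hp⟩ z _ k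
    exact Finset.prod_eq_zero (Finset.mem_univ p) (by rw [hp, Matrix.mul_zero, Matrix.zero_apply])
  constructor
  · rintro ⟨h, h' | ⟨-, h'⟩ | h'⟩
    exacts [.inl h', .inr ⟨.inl h', h⟩, .inr ⟨.inr h', h⟩]
  · rintro (h' | ⟨h' | h', h⟩)
    exacts [⟨hzero h', .inl h'⟩, ⟨h, .inr (.inl ⟨inferInstance, h'⟩)⟩, ⟨h, .inr (.inr h')⟩]

end Core

section BlockMatrix

variable {s : ℕ} {α : Fin s → Type*} [∀ i, Fintype (α i)] [∀ i, DecidableEq (α i)]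

/-- The leading principal block submatrix made of the blocks preceding the `i`-th one. -/
def leadBlock (A : Matrix (Σ i : Fin s, α i) (Σ i : Fin s, α i) ℂ) (i : Fin s) :
    Matrix {y : Σ i : Fin s, α i // (y.1 : ℕ) < (i : ℕ)}
      {y : Σ i : Fin s, α i // (y.1 : ℕ) < (i : ℕ)} ℂ :=
  A.submatrix Subtype.val Subtype.val

/-- The part of the `i`-th block column above the diagonal block. -/
def leadColumn (A : Matrix (Σ i : Fin s, α i) (Σ i : Fin s, α i) ℂ) (i : Fin s) :
    Matrix {y : Σ i : Fin s, α i // (y.1 : ℕ) < (i : ℕ)} (α i) ℂ :=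
  A.submatrix Subtype.val (Sigma.mk i)

/-- The indices of the first `i + 1` blocks are those of the first `i` ones and those of
block `i`. -/
noncomputable def leadIndexEquiv (α : Fin s → Type*) (i : Fin s) :
    {y : Σ i : Fin s, α i // (y.1 : ℕ) < (i : ℕ)} ⊕ α i ≃
      {y : Σ i : Fin s, α i // (y.1 : ℕ) < (i : ℕ) + 1} :=
  Equiv.ofBijective
    (Sum.elim (fun y => ⟨y.1, y.2.trans (Nat.lt_succ_self _)⟩)
      fun a => ⟨⟨i, a⟩, Nat.lt_succ_self _⟩) <| by
    constructor
    · rintro (⟨⟨j, a⟩, hj⟩ | a) (⟨⟨k, b⟩, hk⟩ | b) h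
      · simpa using h
      · obtain ⟨rfl, -⟩ := Sigma.mk.inj_iff.1 (Subtype.mk.inj h)
        exact absurd hj (lt_irrefl _)
      · obtain ⟨rfl, -⟩ := Sigma.mk.inj_iff.1 (Subtype.mk.inj h)
        exact absurd hk (lt_irrefl _)
      · simpa using h
    · rintro ⟨⟨j, a⟩, hj⟩
      rcases Nat.lt_succ_iff_lt_or_eq.1 hj with h | h
      · exact ⟨.inl ⟨⟨j, a⟩, h⟩, rfl⟩
      · obtain rfl : j = i := Fin.ext h
        exact ⟨.inr a, rfl⟩

variable {A : Matrix (Σ i : Fin s, α i) (Σ i : Fin s, α i) ℂ} (hA : A.PosDef) (i : Fin s)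
include hA

omit [∀ i, Fintype (α i)] [∀ i, DecidableEq (α i)] in
theorem leadBlock_posDef : (leadBlock A i).PosDef := hA.submatrix Subtype.val_injective

omit [∀ i, Fintype (α i)] [∀ i, DecidableEq (α i)] in
theorem blk_self_posDef : (blk A i i).PosDef :=
  hA.submatrix (e := Sigma.mk i) sigma_mk_injective

omit [∀ i, Fintype (α i)] [∀ i, DecidableEq (α i)] in
theorem submatrix_leadIndexEquiv :
    (A.submatrix Subtype.val Subtype.val).submatrix (leadIndexEquiv α i) (leadIndexEquiv α i) =
      fromBlocks (leadBlock A i) (leadColumn A i) (leadColumn A i)ᴴ (blk A i i) := by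
  ext (x | x) (y | y)
  · rfl
  · rfl
  · exact (hA.1.apply _ _).symm
  · rfl

theorem blockLeadDet_succ : blockLeadDet A ((i : ℕ) + 1) = blockLeadDet A i *
    (blk A i i - (leadColumn A i)ᴴ * (leadBlock A i)⁻¹ * leadColumn A i).det := by
  have := (leadBlock_posDef hA i).isUnit.invertible
  rw [blockLeadDet, ← det_submatrix_equiv_self (leadIndexEquiv α i), submatrix_leadIndexEquiv hA,
    det_fromBlocks₁₁, invOf_eq_nonsing_inv]
  rfl

theorem schurComplement_posDef :
    (blk A i i - (leadColumn A i)ᴴ * (leadBlock A i)⁻¹ * leadColumn A i).PosDef := by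
  have hB := leadBlock_posDef hA i
  have := hB.isUnit.invertible
  have hsub : (fromBlocks (leadBlock A i) (leadColumn A i) (leadColumn A i)ᴴ (blk A i i)).PosDef :=
    submatrix_leadIndexEquiv hA i ▸
      (hA.submatrix Subtype.val_injective).submatrix (leadIndexEquiv α i).injective
  refine ((PosDef.fromBlocks₁₁ _ _ hB).1 hsub.posSemidef).posDef_iff_det_ne_zero.2 fun h => ?_
  have hdet := hsub.det_pos.ne'
  rw [det_fromBlocks₁₁, invOf_eq_nonsing_inv, h, mul_zero] at hdet
  exact hdet rfl

theorem blockLeadDet_ratio : (blockLeadDet A ((i : ℕ) + 1)).re / (blockLeadDet A i).re =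
    (blk A i i - (leadColumn A i)ᴴ * (leadBlock A i)⁻¹ * leadColumn A i).det.re := by
  have h : blockLeadDet A i = ((blockLeadDet A i).re : ℂ) := (leadBlock_posDef hA i).det_eq_re
  have h0 : 0 < (blockLeadDet A i).re := (leadBlock_posDef hA i).det_re_pos
  rw [blockLeadDet_succ hA, h, Complex.re_ofReal_mul, Complex.ofReal_re,
    mul_div_cancel_left₀ _ h0.ne']

omit [∀ i, Fintype (α i)] [∀ i, DecidableEq (α i)] in
theorem leadColumn_eq_zero_iff :
    leadColumn A i = 0 ↔ ∀ l, l < i → blk A l i = 0 ∧ blk A i l = 0 := by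
  constructor
  · intro h l hl
    have h' : ∀ x y, A ⟨l, x⟩ ⟨i, y⟩ = 0 := fun x y => congrFun (congrFun h ⟨⟨l, x⟩, hl⟩) y
    refine ⟨by ext x y; exact h' x y, ?_⟩
    ext y x
    change A ⟨i, y⟩ ⟨l, x⟩ = 0
    rw [← hA.1.apply, h', star_zero]
  · intro h
    ext ⟨⟨l, x⟩, hl⟩ y
    exact congrFun (congrFun (h l hl).1 x) y

/-- The coefficients expressing the part of block column `i` above the diagonal through the
preceding block columns only involve block column `i₀` iff this part is the corresponding multiple
of block column `i₀`. -/
theorem inv_leadBlock_mul_leadColumn_supported_iff {i₀ : Fin s} (hi₀ : i₀ < i) :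
    (∀ w k, w.1.1 ≠ i₀ → ((leadBlock A i)⁻¹ * leadColumn A i) w k = 0) ↔
      ∀ l, l < i → blk A l i = blk A l i₀ * (blk A i₀ i₀)⁻¹ * blk A i₀ i := by
  have hBu := (isUnit_iff_isUnit_det _).1 (leadBlock_posDef hA i).isUnit
  have hDu := (isUnit_iff_isUnit_det _).1 (blk_self_posDef hA i₀).isUnit
  let e : α i₀ → {y : Σ i : Fin s, α i // (y.1 : ℕ) < (i : ℕ)} := fun a => ⟨⟨i₀, a⟩, hi₀⟩
  have he : Function.Injective e := fun a b h => by simpa [e] using h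
  have hrange : ∀ w, w ∉ Set.range e ↔ w.1.1 ≠ i₀ := fun w => not_congr <| by
    constructor
    · rintro ⟨a, rfl⟩
      rfl
    · obtain ⟨⟨l, a⟩, hl⟩ := w
      rintro rfl
      exact ⟨a, rfl⟩
  constructor
  · intro h
    have hC := mul_eq_submatrix_mul_submatrix he (fun z hz k => h z k ((hrange z).1 hz))
      (leadBlock A i)
    rw [← Matrix.mul_assoc, mul_nonsing_inv _ hBu, Matrix.one_mul] at hC
    generalize ((leadBlock A i)⁻¹ * leadColumn A i).submatrix e id = v at hC
    have hblk : ∀ l, l < i → blk A l i = blk A l i₀ * v := fun l hl => by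
      ext x k
      exact congrFun (congrFun hC ⟨⟨l, x⟩, hl⟩) k
    intro l hl
    rw [hblk l hl, hblk i₀ hi₀, Matrix.mul_assoc, ← Matrix.mul_assoc _ (blk A i₀ i₀),
      nonsing_inv_mul _ hDu, Matrix.one_mul]
  · intro h w k hw
    let E : Matrix {y : Σ i : Fin s, α i // (y.1 : ℕ) < (i : ℕ)} (α i₀) ℂ :=
      (1 : Matrix {y : Σ i : Fin s, α i // (y.1 : ℕ) < (i : ℕ)} _ ℂ).submatrix id e
    have hC : leadColumn A i = leadBlock A i * (E * ((blk A i₀ i₀)⁻¹ * blk A i₀ i)) := by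
      have hE : leadBlock A i * E = (leadBlock A i).submatrix id e := by
        conv_rhs => rw [← Matrix.mul_one (leadBlock A i)]
        rfl
      rw [← Matrix.mul_assoc, hE]
      ext ⟨⟨l, x⟩, hl⟩ y
      have := congrFun (congrFun (h l hl) x) y
      rw [Matrix.mul_assoc] at this
      exact this
    rw [hC, ← Matrix.mul_assoc, nonsing_inv_mul _ hBu, Matrix.one_mul]
    exact one_submatrix_mul_apply_of_notMem_range _ ((hrange w).2 hw) k

end BlockMatrix

section KhatriRao

variable {m s : ℕ} {nn : Fin s → Fin m → ℕ}

/-- The inclusion of the leading indices of a Khatri–Rao product into those of the Kronecker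
product of the leading blocks of the factors. -/
def leadIndexEmb (nn : Fin s → Fin m → ℕ) (i : Fin s)
    (y : {y : Σ i : Fin s, ∀ p, Fin (nn i p) // (y.1 : ℕ) < (i : ℕ)}) (p : Fin m) :
    {y : Σ i : Fin s, Fin (nn i p) // (y.1 : ℕ) < (i : ℕ)} :=
  ⟨⟨y.1.1, y.1.2 p⟩, y.2⟩

theorem sigma_pi_injective [Nonempty (Fin m)] : Function.Injective
    fun (x : Σ i : Fin s, ∀ p, Fin (nn i p)) (p : Fin m) =>
      (⟨x.1, x.2 p⟩ : Σ i : Fin s, Fin (nn i p)) := by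
  rintro ⟨j, a⟩ ⟨k, b⟩ h
  obtain ⟨p₀⟩ := ‹Nonempty (Fin m)›
  obtain ⟨rfl, -⟩ := Sigma.mk.inj_iff.1 (congrFun h p₀)
  congr 1
  funext p
  simpa using congrFun h p

theorem leadIndexEmb_injective [Nonempty (Fin m)] (i : Fin s) :
    Function.Injective (leadIndexEmb nn i) := fun _ _ h =>
  Subtype.ext (sigma_pi_injective (funext fun p => congrArg Subtype.val (congrFun h p)))

theorem mem_range_leadIndexEmb_iff [Nonempty (Fin m)] {i : Fin s}
    {z : ∀ p, {y : Σ i : Fin s, Fin (nn i p) // (y.1 : ℕ) < (i : ℕ)}} :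
    z ∈ Set.range (leadIndexEmb nn i) ↔ ∃ l, ∀ p, (z p).1.1 = l := by
  constructor
  · rintro ⟨y, rfl⟩
    exact ⟨y.1.1, fun p => rfl⟩
  · rintro ⟨l, h⟩
    have hex : ∀ p, ∃ a : Fin (nn l p), (⟨l, a⟩ : Σ i : Fin s, Fin (nn i p)) = (z p).1 :=
      fun p => by
        have aux : ∀ y : Σ i : Fin s, Fin (nn i p), y.1 = l →
            ∃ a : Fin (nn l p), (⟨l, a⟩ : Σ i : Fin s, Fin (nn i p)) = y := by
          rintro ⟨_, a⟩ rfl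
          exact ⟨a, rfl⟩
        exact aux _ (h p)
    choose a ha using hex
    obtain ⟨p₀⟩ := ‹Nonempty (Fin m)›
    exact ⟨⟨⟨l, a⟩, h p₀ ▸ (z p₀).2⟩, funext fun p => Subtype.ext (ha p)⟩

end KhatriRao

/-- Blockwise Oppenheim–Schur inequality for the Khatri–Rao product
`M = A¹ ∗ ⋯ ∗ Aᵐ` of positive definite symmetric-partitioned `s × s` block
matrices (`Aᵖ` with blocks of sizes `nn i p × nn j p`, `σ i p = ∏_{q ≠ p} nn i q`):
for each `i`,
`det (M)_{i+1} / det (M)_i ≥ ∏_p det(Aᵖᵢᵢ)^{σ_{ip}} − ∏_p (det(Aᵖᵢᵢ)^{σ_{ip}} −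
(det (Aᵖ)_{i+1} / det (Aᵖ)_i)^{σ_{ip}})` (indices `i` here are 0-based, so `(·)_i`
is the leading principal block submatrix of the first `i` blocks), with equality
iff (a) `m = 1` or `i = 0`; or (b) some `Aᵖ` has `Aᵖ_{li} = 0 = Aᵖ_{il}` for all
`l < i`; or (c) `nn i p = 1` for every `p` and there is `i₀ < i` with
`Aᵖ_{li} = Aᵖ_{li₀} (Aᵖ_{i₀i₀})⁻¹ Aᵖ_{i₀i}` for all `l < i` and all `p`. -/
theorem stmt_13 {m s : ℕ} (hm : 1 ≤ m) (nn : Fin s → Fin m → ℕ)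
    (A : ∀ p : Fin m,
      Matrix (Σ i : Fin s, Fin (nn i p)) (Σ i : Fin s, Fin (nn i p)) ℂ)
    (hA : ∀ p, (A p).PosDef)
    (M : Matrix (Σ i : Fin s, ∀ p, Fin (nn i p))
      (Σ i : Fin s, ∀ p, Fin (nn i p)) ℂ)
    (hM : ∀ x y, M x y = ∏ p, A p ⟨x.1, x.2 p⟩ ⟨y.1, y.2 p⟩)
    (i : Fin s) :
    ((∏ p, (blk (A p) i i).det.re ^ ∏ q ∈ Finset.univ.erase p, nn i q) -
        ∏ p, ((blk (A p) i i).det.re ^ ∏ q ∈ Finset.univ.erase p, nn i q -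
          ((blockLeadDet (A p) ((i : ℕ) + 1)).re /
            (blockLeadDet (A p) (i : ℕ)).re) ^ ∏ q ∈ Finset.univ.erase p, nn i q)
      ≤ (blockLeadDet M ((i : ℕ) + 1)).re / (blockLeadDet M (i : ℕ)).re) ∧
    ((blockLeadDet M ((i : ℕ) + 1)).re / (blockLeadDet M (i : ℕ)).re
        = (∏ p, (blk (A p) i i).det.re ^ ∏ q ∈ Finset.univ.erase p, nn i q) -
          ∏ p, ((blk (A p) i i).det.re ^ ∏ q ∈ Finset.univ.erase p, nn i q -
            ((blockLeadDet (A p) ((i : ℕ) + 1)).re /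
              (blockLeadDet (A p) (i : ℕ)).re) ^ ∏ q ∈ Finset.univ.erase p, nn i q)
      ↔ (m = 1 ∨ (i : ℕ) = 0) ∨
        (∃ p, ∀ l, l < i → blk (A p) l i = 0 ∧ blk (A p) i l = 0) ∨
        ((∀ p, nn i p = 1) ∧ ∃ i₀, i₀ < i ∧ ∀ l, l < i → ∀ p,
          blk (A p) l i
            = blk (A p) l i₀ * (blk (A p) i₀ i₀)⁻¹ * blk (A p) i₀ i)) := by
  have hne : Nonempty (Fin m) := ⟨⟨0, hm⟩⟩
  have hMsub : M = (piKron A).submatrix (fun x p => ⟨x.1, x.2 p⟩) (fun x p => ⟨x.1, x.2 p⟩) := by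
    ext x y
    exact hM x y
  have hMpos : M.PosDef := hMsub ▸ (piKron_posDef hA).submatrix sigma_pi_injective
  have hcore := det_schurComplement_piKron (leadIndexEmb_injective (nn := nn) i)
    (fun p => leadBlock_posDef (hA p) i) (fun p => blk_self_posDef (hA p) i)
    (fun p => schurComplement_posDef (hA p) i)
  have hlead : leadBlock M i = (piKron fun p => leadBlock (A p) i).submatrix
      (leadIndexEmb nn i) (leadIndexEmb nn i) := by
    rw [hMsub]
    rfl
  have hcol : leadColumn M i = (piKron fun p => leadColumn (A p) i).submatrix
      (leadIndexEmb nn i) id := by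
    rw [hMsub]
    rfl
  have hdiag : blk M i i = piKron fun p => blk (A p) i i := by
    rw [hMsub]
    rfl
  simp only [blockLeadDet_ratio (hA _), blockLeadDet_ratio hMpos, hlead, hcol, hdiag]
  simp only [Fintype.card_fin] at hcore
  refine ⟨hcore.1, hcore.2.trans ?_⟩
  simp only [leadColumn_eq_zero_iff (hA _), Fin.subsingleton_iff_le_one]
  constructor
  · rintro (h | ⟨h | h1, hsupp⟩)
    · exact .inr (.inl h)
    · exact .inl (.inl (le_antisymm h hm))
    · by_cases hm1 : m = 1
      · exact .inl (.inl hm1)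
      by_cases hb : ∃ p, ∀ l, l < i → blk (A p) l i = 0 ∧ blk (A p) i l = 0
      · exact .inr (.inl hb)
      refine .inr (.inr ⟨h1, ?_⟩)
      have hentry : ∀ p, ∃ w k, ((leadBlock (A p) i)⁻¹ * leadColumn (A p) i) w k ≠ 0 := by
        intro p
        by_contra! hzero
        refine hb ⟨p, (leadColumn_eq_zero_iff (hA p) i).1 ?_⟩
        have hBu := (isUnit_iff_isUnit_det _).1 (leadBlock_posDef (hA p) i).isUnit
        rw [← Matrix.one_mul (leadColumn (A p) i), ← mul_nonsing_inv _ hBu, Matrix.mul_assoc,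
          show (leadBlock (A p) i)⁻¹ * leadColumn (A p) i = 0 from Matrix.ext hzero,
          Matrix.mul_zero]
      choose z k hzk using hentry
      have hmem : ∀ z' : ∀ p, {y : Σ i : Fin s, Fin (nn i p) // (y.1 : ℕ) < (i : ℕ)},
          (∀ p, ((leadBlock (A p) i)⁻¹ * leadColumn (A p) i) (z' p) (k p) ≠ 0) →
            ∃ l, ∀ p, (z' p).1.1 = l := fun z' hz' => by
        rw [← mem_range_leadIndexEmb_iff]
        by_contra hmem
        exact Finset.prod_ne_zero_iff.2 (fun p _ => hz' p) (hsupp z' hmem k)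
      obtain ⟨i₀, hi₀⟩ := hmem z hzk
      have hlt : i₀ < i := hi₀ ⟨0, hm⟩ ▸ (z ⟨0, hm⟩).2
      refine ⟨i₀, hlt, fun l hl p =>
        (inv_leadBlock_mul_leadColumn_supported_iff (hA p) i hlt).1 (fun w k' hw => ?_) l hl⟩
      by_contra hwk
      have : Subsingleton (Fin (nn i p)) := Fin.subsingleton_iff_le_one.2 (h1 p).le
      have : Nontrivial (Fin m) := Fin.nontrivial_iff_two_le.2 (by lia)
      obtain ⟨q, hq⟩ := exists_ne p
      obtain ⟨l', hl'⟩ := hmem (Function.update z p w) fun p' => by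
        by_cases hp : p' = p
        · subst hp
          rwa [Function.update_self, Subsingleton.elim (k p') k']
        · rw [Function.update_of_ne hp]
          exact hzk p'
      have hp' := hl' p
      have hq' := hl' q
      rw [Function.update_self] at hp'
      rw [Function.update_of_ne hq, hi₀] at hq'
      exact hw (hp'.trans hq'.symm)
  · rintro ((h | h) | h | ⟨h1, i₀, hlt, hc⟩)
    · refine .inr ⟨.inl h.le, fun z hz => absurd (mem_range_leadIndexEmb_iff.2 ?_) hz⟩
      have := Fin.subsingleton_iff_le_one.2 h.le
      exact ⟨(z ⟨0, hm⟩).1.1, fun p => by rw [Subsingleton.elim p ⟨0, hm⟩]⟩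
    · exact .inl ⟨⟨0, hm⟩, fun l hl => absurd (Fin.lt_def.1 hl) (by lia)⟩
    · exact .inl h
    · refine .inr ⟨.inr h1, fun z hz k => ?_⟩
      obtain ⟨p, hp⟩ : ∃ p, (z p).1.1 ≠ i₀ := by
        by_contra! hall
        exact hz (mem_range_leadIndexEmb_iff.2 ⟨i₀, hall⟩)
      exact Finset.prod_eq_zero (Finset.mem_univ p)
        ((inv_leadBlock_mul_leadColumn_supported_iff (hA p) i hlt).2 (fun l hl => hc l hl p) _ _ hp)
end

section
/- Let m ≥ 1 and for p = 1, …, m let A^p = (A^p_{ij})_{i,j=1}^s be a positive semidefinite s×s block matrix over ℂ all of whose blocks A^p_{ij} are t_p × t_p matrices. Set σ_p := ( ∏_{q=1}^m t_q ) / t_p (a positive integer) and let ⊙A := A^1 ∗ ⋯ ∗ A^m be the Khatri–Rao product. Then det(⊙A) ≥ ∏_{p=1}^m ∏_{i=1}^s det(A^p_{ii})^{σ_p} − ∏_{p=1}^m ( ∏_{i=1}^s det(A^p_{ii})^{σ_p} − det(A^p)^{σ_p} ). -/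
open scoped ComplexOrder

open Finset in
theorem mul_prod_sub_prod_sub_ge {ι : Type*} (s : Finset ι) (α a β b : ι → ℝ)
    (ha : ∀ i, 0 ≤ a i) (haα : ∀ i, a i ≤ α i) (hb : ∀ i, 0 ≤ b i) (hbβ : ∀ i, b i ≤ β i) :
    ∏ i ∈ s, (α i * β i) - ∏ i ∈ s, (α i * β i - a i * b i) ≤
      (∏ i ∈ s, α i - ∏ i ∈ s, (α i - a i)) * (∏ i ∈ s, β i - ∏ i ∈ s, (β i - b i)) := by
  classical
  have key : (∏ i ∈ s, α i) * ∏ i ∈ s, (β i - b i) + (∏ i ∈ s, (α i - a i)) * ∏ i ∈ s, β i -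
      (∏ i ∈ s, (α i - a i)) * ∏ i ∈ s, (β i - b i) ≤ ∏ i ∈ s, (α i * β i - a i * b i) := by
    induction s using Finset.induction_on with
    | empty => simp
    | insert i s hi ih =>
      simp only [prod_insert hi]
      have hY : 0 ≤ ∏ i ∈ s, (α i - a i) := prod_nonneg fun i _ ↦ sub_nonneg.2 (haα i)
      have hY' : 0 ≤ ∏ i ∈ s, (β i - b i) := prod_nonneg fun i _ ↦ sub_nonneg.2 (hbβ i)
      have hX : ∏ i ∈ s, (α i - a i) ≤ ∏ i ∈ s, α i :=
        prod_le_prod (fun i _ ↦ sub_nonneg.2 (haα i)) fun i _ ↦ sub_le_self _ (ha i)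
      have hX' : ∏ i ∈ s, (β i - b i) ≤ ∏ i ∈ s, β i :=
        prod_le_prod (fun i _ ↦ sub_nonneg.2 (hbβ i)) fun i _ ↦ sub_le_self _ (hb i)
      generalize ∏ i ∈ s, (α i - a i) = Y at *
      generalize ∏ i ∈ s, (β i - b i) = Y' at *
      generalize ∏ i ∈ s, α i = X at *
      generalize ∏ i ∈ s, β i = X' at *
      have hc := sub_nonneg.2 (haα i)
      have hd := sub_nonneg.2 (hbβ i)
      have h0 : 0 ≤ α i * β i - a i * b i :=
        sub_nonneg.2 (mul_le_mul (haα i) (hbβ i) (hb i) ((ha i).trans (haα i)))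
      have h1 := mul_nonneg (mul_nonneg (mul_nonneg hY hd) (ha i)) (sub_nonneg.2 hX')
      have h2 := mul_nonneg (mul_nonneg (mul_nonneg hY' hc) (hb i)) (sub_nonneg.2 hX)
      have h3 := mul_le_mul_of_nonneg_left ih h0
      linarith
  rw [prod_mul_distrib]
  linarith

theorem prod_one_sub_prod_ge {ι κ : Type*} [Fintype ι] (s : Finset κ) (d : ι → κ → ℝ)
    (h0 : ∀ i k, 0 ≤ d i k) (h1 : ∀ i k, d i k ≤ 1) :
    1 - ∏ i, (1 - ∏ k ∈ s, d i k) ≤ ∏ k ∈ s, (1 - ∏ i, (1 - d i k)) := by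
  classical
  induction s using Finset.induction_on with
  | empty => simp
  | insert k s hk ih =>
    simp only [Finset.prod_insert hk]
    have := mul_prod_sub_prod_sub_ge Finset.univ (fun _ ↦ 1) (fun i ↦ d i k) (fun _ ↦ 1)
      (fun i ↦ ∏ k ∈ s, d i k) (fun i ↦ h0 i k) (fun i ↦ h1 i k)
      (fun i ↦ Finset.prod_nonneg fun k _ ↦ h0 i k)
      (fun i ↦ Finset.prod_le_one (fun k _ ↦ h0 i k) fun k _ ↦ h1 i k)
    simp only [mul_one, Finset.prod_const_one] at this
    refine this.trans (mul_le_mul_of_nonneg_left ih (sub_nonneg.2 ?_))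
    exact Finset.prod_le_one (fun i _ ↦ sub_nonneg.2 (h1 i k)) fun i _ ↦ sub_le_self _ (h0 i k)

theorem prod_pi_eval {P : Type*} [Fintype P] [DecidableEq P] {τ : P → Type*}
    [∀ p, Fintype (τ p)] {R : Type*} [CommMonoid R] (p : P) (f : τ p → R) :
    ∏ x : ∀ p, τ p, f (x p) =
      (∏ i, f i) ^ ∏ q ∈ Finset.univ.erase p, Fintype.card (τ q) := by
  classical
  rw [← (Equiv.piSplitAt p τ).symm.prod_comp, Fintype.prod_prod_type]
  simp only [Equiv.piSplitAt_symm_apply, dite_true, Finset.prod_const, Finset.prod_pow,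
    Finset.card_univ, Fintype.card_pi]
  congr 1
  exact (Finset.prod_subtype _ (by simp) fun q ↦ Fintype.card (τ q)).symm

namespace Matrix

open scoped MatrixOrder

variable {P : Type*} {τ : P → Type*}

/-- The Kronecker product of a finite family of square matrices. -/
def piKronecker [Fintype P] (A : ∀ p, Matrix (τ p) (τ p) ℂ) :
    Matrix (∀ p, τ p) (∀ p, τ p) ℂ :=
  of fun x y ↦ ∏ p, A p (x p) (y p)

theorem piKronecker_mul [Fintype P] [DecidableEq P] [∀ p, Fintype (τ p)]
    (A B : ∀ p, Matrix (τ p) (τ p) ℂ) :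
    piKronecker (fun p ↦ A p * B p) = piKronecker A * piKronecker B := by
  ext x y
  simp only [piKronecker, of_apply, mul_apply, Finset.prod_univ_sum, Fintype.piFinset_univ,
    Finset.prod_mul_distrib]

theorem conjTranspose_piKronecker [Fintype P] (A : ∀ p, Matrix (τ p) (τ p) ℂ) :
    (piKronecker A)ᴴ = piKronecker fun p ↦ (A p)ᴴ := by
  ext x y
  simp [piKronecker]

theorem piKronecker_diagonal [Fintype P] [DecidableEq (∀ p, τ p)] [∀ p, DecidableEq (τ p)]
    (d : ∀ p, τ p → ℂ) :
    piKronecker (fun p ↦ diagonal (d p)) = diagonal fun x ↦ ∏ p, d p (x p) := by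
  ext x y
  by_cases h : x = y
  · simp [piKronecker, h]
  · obtain ⟨p, hp⟩ := Function.ne_iff.1 h
    rw [diagonal_apply_ne _ h]
    exact Finset.prod_eq_zero (Finset.mem_univ p) (diagonal_apply_ne _ hp)

theorem piKronecker_one [Fintype P] [DecidableEq (∀ p, τ p)] [∀ p, DecidableEq (τ p)] :
    piKronecker (fun p ↦ (1 : Matrix (τ p) (τ p) ℂ)) = 1 := by
  simpa [← diagonal_one] using piKronecker_diagonal fun (p : P) (_ : τ p) ↦ (1 : ℂ)

theorem det_piKronecker_of_isHermitian [Fintype P] [DecidableEq P] [∀ p, Fintype (τ p)]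
    [∀ p, DecidableEq (τ p)] {A : ∀ p, Matrix (τ p) (τ p) ℂ}
    (hA : ∀ p, (A p).IsHermitian) :
    (piKronecker A).det =
      ∏ p, (A p).det ^ ∏ q ∈ Finset.univ.erase p, Fintype.card (τ q) := by
  set U : ∀ p, Matrix (τ p) (τ p) ℂ := fun p ↦ (hA p).eigenvectorUnitary
  set d : ∀ p, τ p → ℂ := fun p i ↦ (hA p).eigenvalues i
  have hU (p) : U p * (U p)ᴴ = 1 := Unitary.coe_mul_star_self _
  have h (p) : A p = U p * diagonal (d p) * (U p)ᴴ := (hA p).spectral_theorem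
  have e : piKronecker A = piKronecker U * piKronecker (fun p ↦ diagonal (d p)) *
      piKronecker fun p ↦ (U p)ᴴ := by
    rw [← piKronecker_mul, ← piKronecker_mul]
    exact congrArg _ (funext h)
  rw [e, det_mul_right_comm, ← piKronecker_mul, funext hU, piKronecker_one, one_mul,
    piKronecker_diagonal, det_diagonal, Finset.prod_comm]
  refine Finset.prod_congr rfl fun p _ ↦ ?_
  rw [prod_pi_eval, (hA p).det_eq_prod_eigenvalues]
  rfl

theorem PosSemidef.piKronecker [Fintype P] [DecidableEq P] [∀ p, Fintype (τ p)]
    {A : ∀ p, Matrix (τ p) (τ p) ℂ} (hA : ∀ p, (A p).PosSemidef) :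
    (piKronecker A).PosSemidef := by
  classical
  choose B hB using fun p ↦ CStarAlgebra.nonneg_iff_eq_star_mul_self.mp (hA p).nonneg
  rw [funext hB, piKronecker_mul]
  simp only [star_eq_conjTranspose, ← conjTranspose_piKronecker]
  exact posSemidef_conjTranspose_mul_self _

section Det

variable {n : Type*} [Fintype n] [DecidableEq n]

theorem PosSemidef.det_eq_ofReal_re {A : Matrix n n ℂ} (hA : A.PosSemidef) :
    A.det = (A.det.re : ℂ) :=
  Complex.eq_re_of_ofReal_le hA.det_nonneg

theorem PosSemidef.det_re_nonneg {A : Matrix n n ℂ} (hA : A.PosSemidef) : 0 ≤ A.det.re :=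
  (Complex.nonneg_iff.1 hA.det_nonneg).1

theorem PosDef.exists_simultaneous_diagonal_s14 {A S : Matrix n n ℂ} (hA : A.PosDef)
    (hS : S.PosSemidef) (hAS : (A - S).PosSemidef) :
    ∃ (Q : Matrix n n ℂ) (d : n → ℝ), A = Q * Qᴴ ∧ S = Q * diagonal (fun i ↦ (d i : ℂ)) * Qᴴ ∧
      ∀ i, 0 ≤ d i ∧ d i ≤ 1 := by
  obtain ⟨B, hB⟩ := CStarAlgebra.nonneg_iff_eq_star_mul_self.mp hA.posSemidef.nonneg
  have hBu : IsUnit B := by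
    have := hA.isUnit
    rw [hB, isUnit_iff_isUnit_det, det_mul] at this
    exact (isUnit_iff_isUnit_det _).2 (isUnit_of_mul_isUnit_right this)
  have hBd := (isUnit_iff_isUnit_det _).1 hBu
  set T := (B⁻¹)ᴴ * S * B⁻¹ with hTdef
  have hT : T.PosSemidef := hS.conjTranspose_mul_mul_same _
  set U : Matrix n n ℂ := (hT.1.eigenvectorUnitary).1
  have hU : U * Uᴴ = 1 := Unitary.coe_mul_star_self _
  have hU' : Uᴴ * U = 1 := Unitary.coe_star_mul_self _
  have hTU : T = U * diagonal (fun i ↦ (hT.1.eigenvalues i : ℂ)) * Uᴴ := hT.1.spectral_theorem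
  have hST : S = Bᴴ * T * B := by
    have h1 : Bᴴ * (B⁻¹)ᴴ = 1 := by
      rw [← conjTranspose_mul, nonsing_inv_mul _ hBd, conjTranspose_one]
    calc S = (Bᴴ * (B⁻¹)ᴴ) * S * (B⁻¹ * B) := by
          rw [h1, nonsing_inv_mul _ hBd, one_mul, mul_one]
      _ = Bᴴ * T * B := by simp only [hTdef, mul_assoc]
  have hA' : A = (Bᴴ * U) * (Bᴴ * U)ᴴ := by
    rw [conjTranspose_mul, conjTranspose_conjTranspose, mul_assoc, ← mul_assoc U, hU, one_mul]
    exact hB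
  have hS' : S = (Bᴴ * U) * diagonal (fun i ↦ (hT.1.eigenvalues i : ℂ)) * (Bᴴ * U)ᴴ := by
    rw [conjTranspose_mul, conjTranspose_conjTranspose]
    conv_lhs => rw [hST, hTU]
    simp only [mul_assoc]
  refine ⟨Bᴴ * U, hT.1.eigenvalues, hA', hS', fun i ↦ ⟨hT.eigenvalues_nonneg i, ?_⟩⟩
  have hQ : IsUnit (Bᴴ * U) := by
    refine IsUnit.mul ?_ (.of_mul_eq_one _ hU)
    exact hBu.star
  have hdiff : A - S =
      (Bᴴ * U) * diagonal (fun i ↦ 1 - (hT.1.eigenvalues i : ℂ)) * star (Bᴴ * U) := by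
    conv_lhs => rw [hS', hA']
    rw [← diagonal_sub (fun _ ↦ (1 : ℂ)), diagonal_one, mul_sub, sub_mul, mul_one]
    rfl
  rw [hdiff, IsUnit.posSemidef_star_right_conjugate_iff hQ, posSemidef_diagonal_iff] at hAS
  have := hAS i
  rw [sub_nonneg] at this
  exact_mod_cast this

theorem PosSemidef.det_re_le_of_sub {X Y : Matrix n n ℂ} (hX : X.PosSemidef)
    (hYX : (Y - X).PosSemidef) : X.det.re ≤ Y.det.re := by
  have hY : Y.PosSemidef := by simpa using hYX.add hX
  by_cases h : X.det = 0
  · simpa [h] using hY.det_re_nonneg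
  have hYd : Y.PosDef := by
    simpa using (hX.posDef_iff_det_ne_zero.2 h).posSemidef_add hYX
  obtain ⟨Q, d, hQ, hd, hd01⟩ := hYd.exists_simultaneous_diagonal_s14 hX hYX
  have : X.det = Y.det * ((∏ i, d i : ℝ) : ℂ) := by
    conv_lhs => rw [hd]
    rw [det_mul_right_comm, ← hQ, det_mul, det_diagonal]
    push_cast
    rfl
  rw [this, Complex.re_mul_ofReal]
  exact mul_le_of_le_one_right hY.det_re_nonneg
    (Finset.prod_le_one (fun i _ ↦ (hd01 i).1) fun i _ ↦ (hd01 i).2)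

end Det

theorem posSemidef_and_det_piKronecker_sub_ge [Fintype P] [DecidableEq P] [∀ p, Fintype (τ p)]
    [∀ p, DecidableEq (τ p)] {A S : ∀ p, Matrix (τ p) (τ p) ℂ} (hA : ∀ p, (A p).PosDef)
    (hS : ∀ p, (S p).PosSemidef) (hAS : ∀ p, (A p - S p).PosSemidef) :
    (piKronecker A - piKronecker fun p ↦ A p - S p).PosSemidef ∧
    ∏ p, (A p).det.re ^ ∏ q ∈ Finset.univ.erase p, Fintype.card (τ q) -
      ∏ p, ((A p).det.re ^ ∏ q ∈ Finset.univ.erase p, Fintype.card (τ q) -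
        (S p).det.re ^ ∏ q ∈ Finset.univ.erase p, Fintype.card (τ q)) ≤
      (piKronecker A - piKronecker fun p ↦ A p - S p).det.re := by
  choose Q d hQ hd hd01 using fun p ↦ (hA p).exists_simultaneous_diagonal_s14 (hS p) (hAS p)
  have hAK : piKronecker A = piKronecker Q * (piKronecker Q)ᴴ := by
    rw [conjTranspose_piKronecker, ← piKronecker_mul, ← funext hQ]
  have hASK : (piKronecker fun p ↦ A p - S p) = piKronecker Q *
      diagonal (fun x ↦ ((∏ p, (1 - d p (x p)) : ℝ) : ℂ)) * (piKronecker Q)ᴴ := by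
    have h (p) : A p - S p = Q p * diagonal (fun i ↦ (1 - d p i : ℂ)) * (Q p)ᴴ := by
      conv_lhs => rw [hd, hQ]
      rw [← diagonal_sub (fun _ ↦ (1 : ℂ)), diagonal_one, mul_sub, sub_mul, mul_one]
    rw [funext h, piKronecker_mul, piKronecker_mul, conjTranspose_piKronecker,
      piKronecker_diagonal]
    push_cast
    rfl
  have hN : (piKronecker A - piKronecker fun p ↦ A p - S p) = piKronecker Q *
      diagonal (fun x ↦ ((1 - ∏ p, (1 - d p (x p)) : ℝ) : ℂ)) * (piKronecker Q)ᴴ := by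
    rw [hASK, hAK]
    simp only [Complex.ofReal_sub]
    rw [← diagonal_sub, Complex.ofReal_one, diagonal_one, mul_sub, sub_mul, mul_one]
  have hprod (x : ∀ p, τ p) : 0 ≤ 1 - ∏ p, (1 - d p (x p)) :=
    sub_nonneg.2 <| Finset.prod_le_one (fun p _ ↦ sub_nonneg.2 (hd01 p _).2)
      fun p _ ↦ sub_le_self _ (hd01 p _).1
  have hdetS (p) : (S p).det.re = (A p).det.re * ∏ i, d p i := by
    have : (S p).det = (A p).det * ((∏ i, d p i : ℝ) : ℂ) := by
      conv_lhs => rw [hd]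
      rw [det_mul_right_comm, ← hQ, det_mul, det_diagonal]
      push_cast
      rfl
    rw [this, Complex.re_mul_ofReal]
  have hdetA : (piKronecker A).det.re =
      ∏ p, (A p).det.re ^ ∏ q ∈ Finset.univ.erase p, Fintype.card (τ q) := by
    have h : (piKronecker A).det = ((∏ p, (A p).det.re ^
        ∏ q ∈ Finset.univ.erase p, Fintype.card (τ q) : ℝ) : ℂ) := by
      rw [det_piKronecker_of_isHermitian fun p ↦ (hA p).1, Complex.ofReal_prod]
      refine Finset.prod_congr rfl fun p _ ↦ ?_
      rw [Complex.ofReal_pow, ← (hA p).posSemidef.det_eq_ofReal_re]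
    rw [h, Complex.ofReal_re]
  have hdetN : (piKronecker A - piKronecker fun p ↦ A p - S p).det.re =
      (piKronecker A).det.re * ∏ x : ∀ p, τ p, (1 - ∏ p, (1 - d p (x p))) := by
    rw [hN, det_mul_right_comm, ← hAK, det_mul, det_diagonal, ← Complex.ofReal_prod,
      Complex.re_mul_ofReal]
  refine ⟨?_, ?_⟩
  · rw [hN]
    refine PosSemidef.mul_mul_conjTranspose_same (PosSemidef.diagonal fun x ↦ ?_) _
    exact Complex.zero_le_real.2 (hprod x)
  rw [hdetN, hdetA]
  simp only [hdetS, mul_pow, ← prod_pi_eval]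
  simp only [← mul_one_sub, Finset.prod_mul_distrib]
  have h0 : 0 ≤ ∏ p, (A p).det.re ^ ∏ q ∈ Finset.univ.erase p, Fintype.card (τ q) :=
    Finset.prod_nonneg fun p _ ↦ pow_nonneg (hA p).posSemidef.det_re_nonneg _
  have h1 := prod_one_sub_prod_ge Finset.univ (fun p (x : ∀ p, τ p) ↦ d p (x p))
    (fun p x ↦ (hd01 p _).1) fun p x ↦ (hd01 p _).2
  exact mul_le_mul_of_nonneg_left h1 h0

theorem PosDef.piKronecker [Fintype P] [DecidableEq P] [∀ p, Fintype (τ p)]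
    {A : ∀ p, Matrix (τ p) (τ p) ℂ} (hA : ∀ p, (A p).PosDef) :
    (piKronecker A).PosDef := by
  classical
  rw [(PosSemidef.piKronecker fun p ↦ (hA p).posSemidef).posDef_iff_det_ne_zero,
    det_piKronecker_of_isHermitian fun p ↦ (hA p).1]
  exact Finset.prod_ne_zero_iff.2 fun p _ ↦ pow_ne_zero _ (hA p).det_pos.ne'

/-- The Khatri–Rao product of a finite family of block matrices. -/
def khatriRao [Fintype P] {κ : Type*} (A : ∀ p, Matrix (κ × τ p) (κ × τ p) ℂ) :
    Matrix (κ × ∀ p, τ p) (κ × ∀ p, τ p) ℂ :=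
  of fun x y ↦ ∏ p, A p (x.1, x.2 p) (y.1, y.2 p)

theorem PosSemidef.khatriRao [Fintype P] [DecidableEq P] [∀ p, Fintype (τ p)] {κ : Type*}
    [Fintype κ] {A : ∀ p, Matrix (κ × τ p) (κ × τ p) ℂ} (hA : ∀ p, (A p).PosSemidef) :
    (khatriRao A).PosSemidef :=
  (PosSemidef.piKronecker hA).submatrix _

theorem PosDef.khatriRao [Fintype P] [DecidableEq P] [Nonempty P] [∀ p, Fintype (τ p)]
    {κ : Type*} [Fintype κ] {A : ∀ p, Matrix (κ × τ p) (κ × τ p) ℂ} (hA : ∀ p, (A p).PosDef) :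
    (khatriRao A).PosDef := by
  refine (PosDef.piKronecker hA).submatrix fun x y h ↦ ?_
  have h' (p : P) := Prod.ext_iff.1 (congrFun h p)
  exact Prod.ext (h' (Classical.arbitrary P)).1 (funext fun p ↦ (h' p).2)

section Split

variable {s : ℕ} {n : Type*}

/-- Splitting off the first of `s + 1` blocks. -/
def splitEquiv (s : ℕ) (n : Type*) : (Fin s × n) ⊕ n ≃ Fin (s + 1) × n where
  toFun := Sum.elim (fun x ↦ (x.1.succ, x.2)) fun i ↦ (0, i)
  invFun x := Fin.cases (Sum.inr x.2) (fun k ↦ Sum.inl (k, x.2)) x.1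
  left_inv x := by rcases x with ⟨k, i⟩ | i <;> rfl
  right_inv x := by
    rcases x with ⟨k, i⟩
    induction k using Fin.cases <;> rfl

/-- The `i`-th diagonal block of a block matrix. -/
def diagBlock {κ : Type*} (A : Matrix (κ × n) (κ × n) ℂ) (i : κ) : Matrix n n ℂ :=
  of fun x y ↦ A (i, x) (i, y)

/-- The block matrix obtained by deleting the first block row and column. -/
def tailBlocks (A : Matrix (Fin (s + 1) × n) (Fin (s + 1) × n) ℂ) :
    Matrix (Fin s × n) (Fin s × n) ℂ :=
  A.submatrix (fun x ↦ (x.1.succ, x.2)) fun x ↦ (x.1.succ, x.2)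

/-- The first block column without its first block. -/
def tailColumn (A : Matrix (Fin (s + 1) × n) (Fin (s + 1) × n) ℂ) : Matrix (Fin s × n) n ℂ :=
  A.submatrix (fun x ↦ (x.1.succ, x.2)) fun i ↦ (0, i)

theorem submatrix_splitEquiv {A : Matrix (Fin (s + 1) × n) (Fin (s + 1) × n) ℂ}
    (hA : A.IsHermitian) : A.submatrix (splitEquiv s n) (splitEquiv s n) =
      fromBlocks (tailBlocks A) (tailColumn A) (tailColumn A)ᴴ (diagBlock A 0) := by
  ext (x | x) (y | y)
  · rfl
  · rfl
  · exact (hA.apply _ _).symm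
  · rfl

theorem PosDef.tailBlocks {A : Matrix (Fin (s + 1) × n) (Fin (s + 1) × n) ℂ} (hA : A.PosDef) :
    (tailBlocks A).PosDef := by
  refine hA.submatrix fun x y h ↦ ?_
  simpa [Prod.ext_iff] using h

theorem PosDef.diagBlock {κ : Type*} {A : Matrix (κ × n) (κ × n) ℂ} (hA : A.PosDef) (i : κ) :
    (diagBlock A i).PosDef :=
  hA.submatrix (Prod.mk_right_injective i)

variable [Fintype n] [DecidableEq n]

/-- The part of the first diagonal block explained by the other blocks. -/
noncomputable def schurCorrection (A : Matrix (Fin (s + 1) × n) (Fin (s + 1) × n) ℂ) :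
    Matrix n n ℂ :=
  (tailColumn A)ᴴ * (tailBlocks A)⁻¹ * tailColumn A

theorem PosDef.posSemidef_schurCorrection {A : Matrix (Fin (s + 1) × n) (Fin (s + 1) × n) ℂ}
    (hA : A.PosDef) : (schurCorrection A).PosSemidef :=
  hA.tailBlocks.posSemidef.inv.conjTranspose_mul_mul_same _

theorem PosDef.posSemidef_fromBlocks_iff {A : Matrix (Fin (s + 1) × n) (Fin (s + 1) × n) ℂ}
    (hA : A.PosDef) (D : Matrix n n ℂ) :
    (fromBlocks (Matrix.tailBlocks A) (tailColumn A) (tailColumn A)ᴴ D).PosSemidef ↔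
      (D - schurCorrection A).PosSemidef :=
  let _ := hA.tailBlocks.isUnit.invertible
  hA.tailBlocks.fromBlocks₁₁ _ _

theorem PosDef.posSemidef_schurComplement {A : Matrix (Fin (s + 1) × n) (Fin (s + 1) × n) ℂ}
    (hA : A.PosDef) : (Matrix.diagBlock A 0 - schurCorrection A).PosSemidef := by
  rw [← hA.posSemidef_fromBlocks_iff, ← submatrix_splitEquiv hA.1]
  exact hA.posSemidef.submatrix _

theorem PosDef.det_re_eq_mul {A : Matrix (Fin (s + 1) × n) (Fin (s + 1) × n) ℂ}
    (hA : A.PosDef) : A.det.re = (Matrix.tailBlocks A).det.re *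
      (Matrix.diagBlock A 0 - schurCorrection A).det.re := by
  let _ := hA.tailBlocks.isUnit.invertible
  rw [← det_submatrix_equiv_self (splitEquiv s n), submatrix_splitEquiv hA.1, det_fromBlocks₁₁,
    hA.tailBlocks.posSemidef.det_eq_ofReal_re, Complex.re_ofReal_mul, invOf_eq_nonsing_inv,
    Complex.ofReal_re]
  rfl

theorem PosDef.det_schurComplement_re_le {A : Matrix (Fin (s + 1) × n) (Fin (s + 1) × n) ℂ}
    (hA : A.PosDef) :
    (Matrix.diagBlock A 0 - schurCorrection A).det.re ≤ (Matrix.diagBlock A 0).det.re :=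
  hA.posSemidef_schurComplement.det_re_le_of_sub <| by
    simpa using hA.posSemidef_schurCorrection

/-- **Fischer's inequality**. -/
theorem PosDef.det_re_le_prod_diagBlock {A : Matrix (Fin s × n) (Fin s × n) ℂ} (hA : A.PosDef) :
    A.det.re ≤ ∏ i, (Matrix.diagBlock A i).det.re := by
  induction s with
  | zero => simp
  | succ s ih =>
    rw [hA.det_re_eq_mul, Fin.prod_univ_succ, mul_comm]
    exact mul_le_mul hA.det_schurComplement_re_le (ih hA.tailBlocks)
      hA.tailBlocks.posSemidef.det_re_nonneg (hA.diagBlock 0).posSemidef.det_re_nonneg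

end Split

variable [Fintype P] [DecidableEq P] [∀ p, Fintype (τ p)] [∀ p, DecidableEq (τ p)] {s : ℕ}

theorem posSemidef_piKronecker_schurCorrection_sub [Nonempty P]
    {A : ∀ p, Matrix (Fin (s + 1) × τ p) (Fin (s + 1) × τ p) ℂ} (hA : ∀ p, (A p).PosDef) :
    ((piKronecker fun p ↦ schurCorrection (A p)) - schurCorrection (khatriRao A)).PosSemidef := by
  rw [← (PosDef.khatriRao hA).posSemidef_fromBlocks_iff]
  let B : ∀ p, Matrix (Fin (s + 1) × τ p) (Fin (s + 1) × τ p) ℂ := fun p ↦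
    (fromBlocks (tailBlocks (A p)) (tailColumn (A p)) (tailColumn (A p))ᴴ
      (schurCorrection (A p))).submatrix (splitEquiv s _).symm (splitEquiv s _).symm
  have hB (p) : (B p).PosSemidef := by
    refine PosSemidef.submatrix ?_ _
    rw [(hA p).posSemidef_fromBlocks_iff, sub_self]
    exact .zero
  have key : fromBlocks (tailBlocks (khatriRao A)) (tailColumn (khatriRao A))
      (tailColumn (khatriRao A))ᴴ (piKronecker fun p ↦ schurCorrection (A p)) =
      (khatriRao B).submatrix (splitEquiv s _) (splitEquiv s _) := by
    ext (x | x) (y | y)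
    · rfl
    · rfl
    · exact map_prod (starRingEnd ℂ) _ _
    · rfl
  rw [key]
  exact (PosSemidef.khatriRao hB).submatrix _

theorem PosDef.det_khatriRao_ge [Nonempty P] {A : ∀ p, Matrix (Fin s × τ p) (Fin s × τ p) ℂ}
    (hA : ∀ p, (A p).PosDef) :
    ∏ p, ∏ i, (Matrix.diagBlock (A p) i).det.re ^
        ∏ q ∈ Finset.univ.erase p, Fintype.card (τ q) -
      ∏ p, (∏ i, (Matrix.diagBlock (A p) i).det.re ^
          ∏ q ∈ Finset.univ.erase p, Fintype.card (τ q) -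
        (A p).det.re ^ ∏ q ∈ Finset.univ.erase p, Fintype.card (τ q)) ≤
      (Matrix.khatriRao A).det.re := by
  induction s with
  | zero => simp
  | succ s ih =>
    have hK := PosDef.khatriRao hA
    obtain ⟨hN, hdet⟩ := posSemidef_and_det_piKronecker_sub_ge (fun p ↦ PosDef.diagBlock (hA p) 0)
      (fun p ↦ (hA p).posSemidef_schurComplement)
      fun p ↦ by simpa using (hA p).posSemidef_schurCorrection
    simp only [sub_sub_cancel] at hN hdet
    have hmono := hN.det_re_le_of_sub (Y := Matrix.diagBlock (Matrix.khatriRao A) 0 -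
      schurCorrection (Matrix.khatriRao A)) <| by
        have := posSemidef_piKronecker_schurCorrection_sub hA
        rwa [← sub_sub_sub_cancel_left _ _
          (Matrix.piKronecker fun p ↦ Matrix.diagBlock (A p) 0)] at this
    rw [hK.det_re_eq_mul]
    refine le_trans ?_ (mul_le_mul_of_nonneg_left (hdet.trans hmono)
      hK.tailBlocks.posSemidef.det_re_nonneg)
    have hb (p) : 0 ≤ (Matrix.diagBlock (A p) 0 - schurCorrection (A p)).det.re :=
      (hA p).posSemidef_schurComplement.det_re_nonneg
    have hbβ (p) := (hA p).det_schurComplement_re_le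
    refine le_trans ?_ (mul_le_mul_of_nonneg_right (ih fun p ↦ (hA p).tailBlocks)
      (sub_nonneg.2 (Finset.prod_le_prod (fun p _ ↦ sub_nonneg.2 (pow_le_pow_left₀ (hb p) (hbβ p) _))
        fun p _ ↦ sub_le_self _ (pow_nonneg (hb p) _))))
    refine le_trans (le_of_eq ?_) (mul_prod_sub_prod_sub_ge Finset.univ _ _ _ _
      (fun p ↦ pow_nonneg (hA p).tailBlocks.posSemidef.det_re_nonneg _) (fun p ↦ ?_)
      (fun p ↦ pow_nonneg (hb p) _) fun p ↦ pow_le_pow_left₀ (hb p) (hbβ p) _)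
    · simp only [Fin.prod_univ_succ, (hA _).det_re_eq_mul, mul_pow]
      congr 1
      · exact Finset.prod_congr rfl fun p _ ↦ mul_comm _ _
      · exact Finset.prod_congr rfl fun p _ ↦ congrArg (· - _) (mul_comm _ _)
    · rw [Finset.prod_pow]
      exact pow_le_pow_left₀ (hA p).tailBlocks.posSemidef.det_re_nonneg
        (hA p).tailBlocks.det_re_le_prod_diagBlock _

theorem PosSemidef.det_khatriRao_ge [Nonempty P] {A : ∀ p, Matrix (Fin s × τ p) (Fin s × τ p) ℂ}
    (hA : ∀ p, (A p).PosSemidef) :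
    ∏ p, ∏ i, (diagBlock (A p) i).det.re ^
        ∏ q ∈ Finset.univ.erase p, Fintype.card (τ q) -
      ∏ p, (∏ i, (diagBlock (A p) i).det.re ^
          ∏ q ∈ Finset.univ.erase p, Fintype.card (τ q) -
        (A p).det.re ^ ∏ q ∈ Finset.univ.erase p, Fintype.card (τ q)) ≤
      (Matrix.khatriRao A).det.re := by
  let B : ℝ → ∀ p, Matrix (Fin s × τ p) (Fin s × τ p) ℂ := fun ε p ↦ A p + (ε : ℂ) • 1
  have hB0 : B 0 = A := by simp [B]
  have hB (p) : Continuous fun ε ↦ B ε p := by fun_prop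
  have hdiag (p i) : Continuous fun ε ↦ diagBlock (B ε p) i :=
    continuous_matrix fun x y ↦ (hB p).matrix_elem _ _
  have hK : Continuous fun ε ↦ Matrix.khatriRao (B ε) :=
    continuous_matrix fun x y ↦ continuous_finsetProd _ fun p _ ↦ (hB p).matrix_elem _ _
  have hdet (p) : Continuous fun ε ↦ (B ε p).det.re := Complex.continuous_re.comp (hB p).matrix_det
  have hdetdiag (p i) : Continuous fun ε ↦ (diagBlock (B ε p) i).det.re :=
    Complex.continuous_re.comp (hdiag p i).matrix_det
  have hdetK : Continuous fun ε ↦ (Matrix.khatriRao (B ε)).det.re :=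
    Complex.continuous_re.comp hK.matrix_det
  have hL : Continuous fun ε ↦ ∏ p, ∏ i, (diagBlock (B ε p) i).det.re ^
        ∏ q ∈ Finset.univ.erase p, Fintype.card (τ q) -
      ∏ p, (∏ i, (diagBlock (B ε p) i).det.re ^
          ∏ q ∈ Finset.univ.erase p, Fintype.card (τ q) -
        (B ε p).det.re ^ ∏ q ∈ Finset.univ.erase p, Fintype.card (τ q)) := by
    fun_prop
  have hpos (ε : ℝ) (hε : 0 < ε) (p) : (B ε p).PosDef :=
    PosDef.posSemidef_add (hA p) (PosDef.one.smul (Complex.zero_lt_real.2 hε))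
  have := le_of_tendsto_of_tendsto (b := nhdsWithin (0 : ℝ) (Set.Ioi 0))
    ((hL.tendsto 0).mono_left nhdsWithin_le_nhds) ((hdetK.tendsto 0).mono_left nhdsWithin_le_nhds)
    (Filter.eventually_of_mem self_mem_nhdsWithin fun ε hε ↦ PosDef.det_khatriRao_ge (hpos ε hε))
  rwa [hB0] at this

end Matrix

/-- Oppenheim–Schur inequality for the Khatri–Rao product `M = A¹ ∗ ⋯ ∗ Aᵐ`
of positive semidefinite `s × s` block matrices `Aᵖ` all of whose blocks are
`t p × t p` matrices (`σ p = ∏_{q ≠ p} t q`):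
`det M ≥ ∏_p ∏_i det(Aᵖᵢᵢ)^{σ_p} − ∏_p (∏_i det(Aᵖᵢᵢ)^{σ_p} − det(Aᵖ)^{σ_p})`. -/
theorem stmt_14 {m s : ℕ} (hm : 1 ≤ m) (t : Fin m → ℕ)
    (A : ∀ p : Fin m, Matrix (Fin s × Fin (t p)) (Fin s × Fin (t p)) ℂ)
    (hA : ∀ p, (A p).PosSemidef)
    (M : Matrix (Fin s × ∀ p, Fin (t p)) (Fin s × ∀ p, Fin (t p)) ℂ)
    (hM : ∀ x y, M x y = ∏ p, A p (x.1, x.2 p) (y.1, y.2 p)) :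
    (∏ p, ∏ i : Fin s,
        (Matrix.of fun x y : Fin (t p) => A p (i, x) (i, y)).det.re
          ^ ∏ q ∈ Finset.univ.erase p, t q) -
      ∏ p, ((∏ i : Fin s,
          (Matrix.of fun x y : Fin (t p) => A p (i, x) (i, y)).det.re
            ^ ∏ q ∈ Finset.univ.erase p, t q) -
        (A p).det.re ^ ∏ q ∈ Finset.univ.erase p, t q)
      ≤ M.det.re := by
  obtain rfl : M = Matrix.khatriRao A := Matrix.ext hM
  have : Nonempty (Fin m) := ⟨⟨0, hm⟩⟩
  have := Matrix.PosSemidef.det_khatriRao_ge hA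
  simp only [Fintype.card_fin] at this
  exact this
end

section
/- Let A = (A_{ij})_{i,j=1}^s be a positive definite symmetric-partitioned s×s block matrix over ℂ. Then for each i = 1, …, s, det (A)_i ≤ det(A_{ii}) · det (A)_{i−1}, and consequently (Fischer's inequality) ∏_{i=1}^s det(A_{ii}) ≥ det A. -/
open scoped ComplexOrder

namespace Matrix

variable {m n 𝕜 : Type*} [Fintype m] [DecidableEq m] [Fintype n] [DecidableEq n] [RCLike 𝕜]

lemma PosSemidef.one_le_det_one_add {Q : Matrix n n 𝕜} (hQ : Q.PosSemidef) :
    1 ≤ (1 + Q).det := by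
  have hH : (1 + Q).IsHermitian := isHermitian_one.add hQ.1
  have hev (i : n) : 1 ≤ hH.eigenvalues i := by
    have hnorm : RCLike.re (star ⇑(hH.eigenvectorBasis i) ⬝ᵥ ⇑(hH.eigenvectorBasis i)) = 1 := by
      rw [dotProduct_comm, ← EuclideanSpace.inner_eq_star_dotProduct,
        inner_self_eq_norm_sq_to_K, hH.eigenvectorBasis.orthonormal.1 i]
      simp
    rw [hH.eigenvalues_eq, add_mulVec, one_mulVec, dotProduct_add, map_add, hnorm]
    linarith [hQ.re_dotProduct_nonneg ⇑(hH.eigenvectorBasis i)]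
  rw [hH.det_eq_prod_eigenvalues]
  exact_mod_cast Finset.one_le_prod fun i _ => hev i

lemma PosDef.det_le_det_add {S P : Matrix n n 𝕜} (hS : S.PosDef) (hP : P.PosSemidef) :
    S.det ≤ (S + P).det := by
  obtain ⟨R, hR, rfl⟩ : ∃ R : Matrix n n 𝕜, IsUnit R ∧ S = Rᴴ * R := by
    open scoped MatrixOrder Matrix.Norms.L2Operator in
    exact CStarAlgebra.isStrictlyPositive_iff_eq_star_mul_self.mp hS.isStrictlyPositive
  have hdet : IsUnit R.det := (isUnit_iff_isUnit_det R).mp hR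
  have hfactor : Rᴴ * R + P = Rᴴ * (1 + (R⁻¹)ᴴ * P * R⁻¹) * R := by
    have hstar : Rᴴ * (R⁻¹)ᴴ = 1 := by
      rw [← conjTranspose_mul, nonsing_inv_mul R hdet, conjTranspose_one]
    calc Rᴴ * R + P = Rᴴ * R + (Rᴴ * (R⁻¹)ᴴ) * P * (R⁻¹ * R) := by
          rw [hstar, nonsing_inv_mul R hdet, one_mul, mul_one]
      _ = _ := by noncomm_ring
  have hQ := (hP.conjTranspose_mul_mul_same R⁻¹).one_le_det_one_add
  have hpos := hS.det_pos.le
  rw [hfactor, det_mul (_ * _), det_mul Rᴴ (1 + _), mul_right_comm, ← det_mul]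
  exact le_mul_of_one_le_right hpos hQ

/-- **Fischer's inequality** for a two-by-two block partition. -/
theorem PosDef.det_le_det_toBlocks {M : Matrix (m ⊕ n) (m ⊕ n) 𝕜} (hM : M.PosDef) :
    M.det ≤ M.toBlocks₁₁.det * M.toBlocks₂₂.det := by
  have hA : M.toBlocks₁₁.PosDef := hM.submatrix Sum.inl_injective
  have hC : M.toBlocks₂₁ = M.toBlocks₁₂ᴴ := by
    ext i j
    exact (hM.1.apply (Sum.inr i) (Sum.inl j)).symm
  have : Invertible M.toBlocks₁₁ := hA.isUnit.invertible
  have hM' : M = fromBlocks M.toBlocks₁₁ M.toBlocks₁₂ M.toBlocks₁₂ᴴ M.toBlocks₂₂ := by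
    rw [← hC, fromBlocks_toBlocks]
  have hdet : M.det = M.toBlocks₁₁.det *
      (M.toBlocks₂₂ - M.toBlocks₁₂ᴴ * M.toBlocks₁₁⁻¹ * M.toBlocks₁₂).det := by
    conv_lhs => rw [hM', det_fromBlocks₁₁, invOf_eq_nonsing_inv]
  have hS : (M.toBlocks₂₂ - M.toBlocks₁₂ᴴ * M.toBlocks₁₁⁻¹ * M.toBlocks₁₂).PosDef := by
    refine PosSemidef.posDef_iff_det_ne_zero ?_ |>.mpr ?_
    · exact (PosDef.fromBlocks₁₁ _ _ hA).mp (hM' ▸ hM.posSemidef)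
    · exact right_ne_zero_of_mul (hdet ▸ hM.det_pos.ne')
  have hle := hS.det_le_det_add (hA.inv.posSemidef.conjTranspose_mul_mul_same M.toBlocks₁₂)
  rw [sub_add_cancel] at hle
  rw [hdet]
  exact mul_le_mul_of_nonneg_left hle hA.det_pos.le

end Matrix

section BlockLeading

variable {s : ℕ} {α : Fin s → Type*}

/-- The indices of the first `i + 1` blocks are those of the first `i` blocks together with those
of block `i`. -/
def blockLeadSuccEquiv (i : Fin s) :
    {y : Σ j, α j // (y.1 : ℕ) < i} ⊕ α i ≃ {y : Σ j, α j // (y.1 : ℕ) < i + 1} where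
  toFun := Sum.elim (fun y => ⟨y.1, y.2.trans (Nat.lt_succ_self _)⟩)
    fun x => ⟨⟨i, x⟩, Nat.lt_succ_self _⟩
  invFun y :=
    if h : (y.1.1 : ℕ) < i then Sum.inl ⟨y.1, h⟩
    else Sum.inr (cast (congrArg α (Fin.ext (by have := y.2; lia))) y.1.2)
  left_inv := by
    rintro (y | x)
    · simp [y.2]
    · simp
      rfl
  right_inv := by
    rintro ⟨⟨j, x⟩, hj⟩
    by_cases h : (j : ℕ) < i
    · simp [h]
    · obtain rfl : j = i := Fin.ext (by simp only at hj; lia)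
      simp

variable {A : Matrix (Σ i, α i) (Σ i, α i) ℂ}

lemma blk_posDef (hA : A.PosDef) (i : Fin s) : (blk A i i).PosDef :=
  hA.submatrix sigma_mk_injective

variable [∀ i, Fintype (α i)] [∀ i, DecidableEq (α i)]

lemma blockLeadDet_zero : blockLeadDet A 0 = 1 := by
  have : IsEmpty {y : Σ i : Fin s, α i // (y.1 : ℕ) < 0} := ⟨fun y => Nat.not_lt_zero _ y.2⟩
  exact Matrix.det_isEmpty

lemma blockLeadDet_self : blockLeadDet A s = A.det :=
  Matrix.det_submatrix_equiv_self (Equiv.subtypeUnivEquiv fun y : Σ i, α i => y.1.2) A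

lemma blockLeadDet_succ_le (hA : A.PosDef) (i : Fin s) :
    blockLeadDet A (i + 1) ≤ (blk A i i).det * blockLeadDet A i := by
  have hM : (A.submatrix (fun x => (blockLeadSuccEquiv i x).1)
      fun x => (blockLeadSuccEquiv i x).1).PosDef :=
    hA.submatrix (Subtype.val_injective.comp (blockLeadSuccEquiv i).injective)
  rw [mul_comm, blockLeadDet, ← Matrix.det_submatrix_equiv_self (blockLeadSuccEquiv i)]
  exact hM.det_le_det_toBlocks

lemma blockLeadDet_le_prod (hA : A.PosDef) (k : ℕ) (hk : k ≤ s) :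
    blockLeadDet A k ≤ ∏ i : Fin k, (blk A (i.castLE hk) (i.castLE hk)).det := by
  induction k with
  | zero => simp [blockLeadDet_zero]
  | succ k ih =>
    rw [Fin.prod_univ_castSucc, mul_comm]
    exact (blockLeadDet_succ_le hA ⟨k, hk⟩).trans
      (mul_le_mul_of_nonneg_left (ih (by lia)) (blk_posDef hA _).det_pos.le)

end BlockLeading

/-- For a positive definite symmetric-partitioned `s × s` block matrix `A`
(0-based block indices): `det (A)_{i+1} ≤ det(Aᵢᵢ) · det (A)_i` for each `i`,
and consequently Fischer's inequality `∏_i det(Aᵢᵢ) ≥ det A`. -/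
theorem stmt_16 {s : ℕ} (nn : Fin s → ℕ)
    (A : Matrix (Σ i : Fin s, Fin (nn i)) (Σ i : Fin s, Fin (nn i)) ℂ)
    (hA : A.PosDef) :
    (∀ i : Fin s,
      (blockLeadDet A ((i : ℕ) + 1)).re
        ≤ (blk A i i).det.re * (blockLeadDet A (i : ℕ)).re) ∧
    A.det.re ≤ ∏ i : Fin s, (blk A i i).det.re := by
  have hre (i : Fin s) : (blk A i i).det = ((blk A i i).det.re : ℂ) :=
    Complex.eq_re_of_ofReal_le (r := 0) (by simpa using (blk_posDef hA i).det_pos.le)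
  refine ⟨fun i => ?_, ?_⟩
  · have h := (Complex.le_def.mp (blockLeadDet_succ_le hA i)).1
    rwa [hre, Complex.re_ofReal_mul] at h
  · have h := (Complex.le_def.mp (blockLeadDet_le_prod hA s le_rfl)).1
    rw [blockLeadDet_self] at h
    refine h.trans_eq ?_
    simp only [Fin.castLE_rfl, id_eq]
    rw [Finset.prod_congr rfl fun i _ => hre i, ← Complex.ofReal_prod, Complex.ofReal_re]
end
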